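/- arXiv:2505.05904 — 5 statements merged into one kernel-verified Lean document; each statement's English description precedes it below -/
import Mathlib

section
/- For all real numbers a ≥ 0 and b ≥ 0 there exists a constant C = C(a,b) > 0 such that for every real λ ≥ 2 the following hold: if a < 1 then Σ_{k=0}^{⌊2λ⌋} (1+|k−λ|)^{−a} (1+k)^{b} ≤ C λ^{b+1−a}; if a = 1 then Σ_{k=0}^{⌊2λ⌋} (1+|k−λ|)^{−1} (1+k)^{b} ≤ C λ^{b} log λ; and if a > 1 then Σ_{k=0}^{⌊2λ⌋} (1+|k−λ|)^{−a} (1+k)^{b} ≤ C λ^{b}. -/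
open Finset in
/-- The partial sums of `∑ (1 + j) ^ (-a)` control the weighted sum on both sides of `lam`. -/
lemma sum_rpow_neg_dist_le {a lam : ℝ} (ha : 0 ≤ a) (hlam : 0 ≤ lam) :
    ∑ k ∈ range (⌊2 * lam⌋₊ + 1), (1 + |(k : ℝ) - lam|) ^ (-a) ≤
      2 * ∑ j ∈ range (⌊lam⌋₊ + 1), (1 + (j : ℝ)) ^ (-a) := by
  have hle : (⌊lam⌋₊ : ℝ) ≤ lam := Nat.floor_le hlam
  have hlt : lam < ⌊lam⌋₊ + 1 := Nat.lt_floor_add_one lam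
  generalize ⌊lam⌋₊ = N at hle hlt ⊢
  have hfloor : ⌊2 * lam⌋₊ < 2 * N + 2 := by
    rw [Nat.floor_lt (by positivity)]
    push_cast
    linarith
  calc ∑ k ∈ range (⌊2 * lam⌋₊ + 1), (1 + |(k : ℝ) - lam|) ^ (-a)
      ≤ ∑ k ∈ range ((N + 1) + (N + 1)), (1 + |(k : ℝ) - lam|) ^ (-a) := by
        refine sum_le_sum_of_subset_of_nonneg (range_subset_range.2 (by omega)) ?_
        intros
        positivity
    _ = ∑ j ∈ range (N + 1), (1 + |((N + 1 - 1 - j : ℕ) : ℝ) - lam|) ^ (-a) +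
        ∑ j ∈ range (N + 1), (1 + |((N + 1 + j : ℕ) : ℝ) - lam|) ^ (-a) := by
        rw [sum_range_add, sum_range_reflect (fun k : ℕ => (1 + |(k : ℝ) - lam|) ^ (-a))]
    _ ≤ ∑ j ∈ range (N + 1), (1 + (j : ℝ)) ^ (-a) + ∑ j ∈ range (N + 1), (1 + (j : ℝ)) ^ (-a) := by
        refine add_le_add (sum_le_sum fun j hj => ?_) (sum_le_sum fun j _ => ?_)
        · refine Real.rpow_le_rpow_of_nonpos (by positivity) ?_ (by linarith)
          have hjN : j ≤ N := by simpa [Nat.lt_succ_iff] using hj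
          rw [Nat.add_sub_cancel, Nat.cast_sub hjN]
          linarith [neg_le_abs ((N : ℝ) - j - lam)]
        · refine Real.rpow_le_rpow_of_nonpos (by positivity) ?_ (by linarith)
          push_cast
          linarith [le_abs_self ((N : ℝ) + 1 + j - lam)]
    _ = 2 * ∑ j ∈ range (N + 1), (1 + (j : ℝ)) ^ (-a) := by ring

open Finset in
lemma weighted_sum_le_mul_sum_rpow_neg {a b lam : ℝ} (ha : 0 ≤ a) (hb : 0 ≤ b) (hlam : 1 ≤ lam) :
    ∑ k ∈ range (⌊2 * lam⌋₊ + 1), (1 + |(k : ℝ) - lam|) ^ (-a) * (1 + (k : ℝ)) ^ b ≤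
      2 * 3 ^ b * lam ^ b * ∑ j ∈ range (⌊lam⌋₊ + 1), (1 + (j : ℝ)) ^ (-a) := by
  have hterm : ∀ k ∈ range (⌊2 * lam⌋₊ + 1),
      (1 + |(k : ℝ) - lam|) ^ (-a) * (1 + (k : ℝ)) ^ b ≤
        (1 + |(k : ℝ) - lam|) ^ (-a) * (3 * lam) ^ b := by
    intro k hk
    have hk' : (k : ℝ) ≤ 2 * lam := by
      rw [← Nat.le_floor_iff (by positivity)]
      simpa [Nat.lt_succ_iff] using hk
    gcongr
    linarith
  refine (sum_le_sum hterm).trans ?_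
  rw [← sum_mul, Real.mul_rpow (by norm_num) (by linarith)]
  calc _ ≤ (2 * ∑ j ∈ range (⌊lam⌋₊ + 1), (1 + (j : ℝ)) ^ (-a)) * (3 ^ b * lam ^ b) := by
        gcongr
        exact sum_rpow_neg_dist_le ha (by linarith)
    _ = _ := by ring

lemma sum_one_add_rpow_neg_le {a : ℝ} (ha : 0 ≤ a) (ha1 : a < 1) (n : ℕ) :
    ∑ j ∈ Finset.range n, (1 + (j : ℝ)) ^ (-a) ≤ (n : ℝ) ^ (1 - a) / (1 - a) := by
  have h1a : 0 < 1 - a := by linarith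
  rw [le_div_iff₀ h1a]
  induction n with
  | zero => simp [Real.zero_rpow h1a.ne']
  | succ n ih =>
    rw [Finset.sum_range_succ, add_mul]
    refine (add_le_add_left ih _).trans ?_
    have hpos : (0 : ℝ) < 1 + n := by positivity
    have bernoulli : (1 + -(1 / (1 + (n : ℝ)))) ^ (1 - a) ≤ 1 + (1 - a) * -(1 / (1 + (n : ℝ))) := by
      refine rpow_one_add_le_one_add_mul_self ?_ h1a.le (by linarith)
      rw [neg_le_neg_iff, div_le_one hpos]
      simp
    have hbase : 1 + -(1 / (1 + (n : ℝ))) = n / (1 + n) := by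
      field_simp
      ring
    rw [hbase, Real.div_rpow (by positivity) hpos.le, div_le_iff₀ (by positivity)] at bernoulli
    have hsplit : (1 + (n : ℝ)) ^ (1 - a) = (1 + n) * (1 + (n : ℝ)) ^ (-a) := by
      rw [sub_eq_add_neg, Real.rpow_add hpos, Real.rpow_one]
    have hcancel : (1 + (1 - a) * -(1 / (1 + (n : ℝ)))) * (1 + n : ℝ) ^ (1 - a) =
        (1 + (n : ℝ)) ^ (1 - a) - (1 + (n : ℝ)) ^ (-a) * (1 - a) := by
      rw [hsplit]
      field_simp
      ring
    rw [hcancel] at bernoulli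
    push_cast
    rw [add_comm (n : ℝ) 1]
    linarith

lemma sum_one_add_rpow_neg_one_le (n : ℕ) :
    ∑ j ∈ Finset.range n, (1 + (j : ℝ)) ^ (-1 : ℝ) ≤ 1 + Real.log n := by
  have h := harmonic_le_one_add_log n
  rw [harmonic] at h
  push_cast at h
  simpa [Real.rpow_neg_one, add_comm] using h

lemma sum_one_add_rpow_neg_le_tsum {a : ℝ} (ha : 1 < a) (n : ℕ) :
    ∑ j ∈ Finset.range n, (1 + (j : ℝ)) ^ (-a) ≤ ∑' j : ℕ, (1 + (j : ℝ)) ^ (-a) := by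
  have h : Summable fun j : ℕ => (1 + (j : ℝ)) ^ (-a) := by
    have := (summable_nat_add_iff 1).2 (Real.summable_nat_rpow.2 (by linarith : -a < -1))
    simpa [add_comm] using this
  exact h.sum_le_tsum _ fun j _ => by positivity

/-- **Weighted spectral sums, low-frequency part.**
For `a, b ≥ 0` there is `C > 0` such that for all `λ ≥ 2`:
if `a < 1` then `∑_{k=0}^{⌊2λ⌋} (1+|k-λ|)^{-a} (1+k)^b ≤ C λ^{b+1-a}`;
if `a = 1` the sum is `≤ C λ^b log λ`; and if `a > 1` it is `≤ C λ^b`. -/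
theorem weighted_spectral_sum_low
    (a b : ℝ) (ha : 0 ≤ a) (hb : 0 ≤ b) :
    ∃ C : ℝ, 0 < C ∧ ∀ lam : ℝ, 2 ≤ lam →
      ((a < 1 →
          ∑ k ∈ Finset.range (⌊2 * lam⌋₊ + 1),
              (1 + |(k : ℝ) - lam|) ^ (-a) * (1 + (k : ℝ)) ^ b
            ≤ C * lam ^ (b + 1 - a)) ∧
        (a = 1 →
          ∑ k ∈ Finset.range (⌊2 * lam⌋₊ + 1),
              (1 + |(k : ℝ) - lam|) ^ (-a) * (1 + (k : ℝ)) ^ b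
            ≤ C * lam ^ b * Real.log lam) ∧
        (1 < a →
          ∑ k ∈ Finset.range (⌊2 * lam⌋₊ + 1),
              (1 + |(k : ℝ) - lam|) ^ (-a) * (1 + (k : ℝ)) ^ b
            ≤ C * lam ^ b)) := by
  have hfloor : ∀ lam : ℝ, 2 ≤ lam → ((⌊lam⌋₊ + 1 : ℕ) : ℝ) ≤ 2 * lam := by
    intro lam hlam
    push_cast
    linarith [Nat.floor_le (by linarith : 0 ≤ lam)]
  rcases lt_trichotomy a 1 with h | rfl | h
  · have h1a : 0 < 1 - a := by linarith
    refine ⟨2 * 3 ^ b * (2 ^ (1 - a) / (1 - a)), by positivity, fun lam hlam =>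
      ⟨fun _ => ?_, fun h' => absurd h' h.ne, fun h' => absurd h' h.not_gt⟩⟩
    have hpos : 0 < lam := by linarith
    refine (weighted_sum_le_mul_sum_rpow_neg ha hb (by linarith)).trans ?_
    calc _ ≤ 2 * 3 ^ b * lam ^ b * ((2 * lam) ^ (1 - a) / (1 - a)) := by
          gcongr
          refine (sum_one_add_rpow_neg_le ha h _).trans ?_
          gcongr
          exact hfloor lam hlam
      _ = _ := by
          rw [Real.mul_rpow (by norm_num) hpos.le, add_sub_assoc, Real.rpow_add hpos]
          ring
  · refine ⟨2 * 3 ^ b * 4, by positivity, fun lam hlam =>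
      ⟨fun h' => absurd h' (lt_irrefl _), fun _ => ?_, fun h' => absurd h' (lt_irrefl _)⟩⟩
    have hpos : 0 < lam := by linarith
    refine (weighted_sum_le_mul_sum_rpow_neg ha hb (by linarith)).trans ?_
    calc _ ≤ 2 * 3 ^ b * lam ^ b * (4 * Real.log lam) := by
          gcongr
          refine (sum_one_add_rpow_neg_one_le _).trans ?_
          have hlog : Real.log ((⌊lam⌋₊ + 1 : ℕ) : ℝ) ≤ Real.log (2 * lam) :=
            Real.log_le_log (by positivity) (hfloor lam hlam)
          rw [Real.log_mul (by norm_num) hpos.ne'] at hlog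
          linarith [Real.log_two_gt_d9, Real.log_le_log (by norm_num) hlam]
      _ = _ := by ring
  · have htsum : 0 < ∑' j : ℕ, (1 + (j : ℝ)) ^ (-a) :=
      zero_lt_one.trans_le (by simpa using sum_one_add_rpow_neg_le_tsum h 1)
    refine ⟨2 * 3 ^ b * ∑' j : ℕ, (1 + (j : ℝ)) ^ (-a), by positivity, fun lam hlam =>
      ⟨fun h' => absurd h' h.not_gt, fun h' => absurd h' h.ne', fun _ => ?_⟩⟩
    have hpos : 0 < lam := by linarith
    refine (weighted_sum_le_mul_sum_rpow_neg ha hb (by linarith)).trans ?_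
    calc _ ≤ 2 * 3 ^ b * lam ^ b * ∑' j : ℕ, (1 + (j : ℝ)) ^ (-a) := by
          gcongr
          exact sum_one_add_rpow_neg_le_tsum h _
      _ = _ := by ring
end

section
/- For all real numbers a ≥ 0 and b ≥ 0 with b − 2a < −1 there exists a constant C = C(a,b) > 0 such that for every real λ ≥ 2: Σ_{k ∈ ℕ, k > 2λ} (k² + λ²)^{−a} (1+k)^{b} ≤ C λ^{b+1−2a}. -/
open Set in
/-- Integral-test bound for the tail of a convergent `p`-series. -/
theorem tsum_natCast_add_rpow_le {p : ℝ} (hp : p < -1) {N : ℕ} (hN : 0 < N) :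
    ∑' n : ℕ, ((n + N + 1 : ℕ) : ℝ) ^ p ≤ (N : ℝ) ^ (p + 1) / (-(p + 1)) := by
  have hN' : (0 : ℝ) < N := by exact_mod_cast hN
  have anti : AntitoneOn (fun x : ℝ => x ^ p) (Ici (N : ℝ)) := fun x hx y _ hxy =>
    Real.rpow_le_rpow_of_nonpos (hN'.trans_le hx) hxy (by linarith)
  have key := anti.tsum_comp_add_le_integral N (integrableOn_Ioi_rpow_of_lt hp hN')
    fun t ht => Real.rpow_nonneg (hN'.trans ht).le p
  rwa [integral_Ioi_rpow_of_lt hp hN', neg_div, ← div_neg] at key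

/-- For `k ≥ 1` the spectral weight is dominated by a pure power of `k`. -/
theorem weight_le_rpow {a b k lam : ℝ} (ha : 0 ≤ a) (hb : 0 ≤ b) (hk : 1 ≤ k) :
    (k ^ 2 + lam ^ 2) ^ (-a) * (1 + k) ^ b ≤ 2 ^ b * k ^ (b - 2 * a) := by
  have hk0 : 0 < k := by linarith
  calc (k ^ 2 + lam ^ 2) ^ (-a) * (1 + k) ^ b
      ≤ (k ^ 2) ^ (-a) * (2 * k) ^ b := by
        gcongr ?_ * ?_
        · exact Real.rpow_le_rpow_of_nonpos (by positivity)
            (le_add_of_nonneg_right (sq_nonneg lam)) (by linarith)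
        · exact Real.rpow_le_rpow (by positivity) (by linarith) hb
    _ = 2 ^ b * k ^ (b - 2 * a) := by
        rw [Real.mul_rpow zero_le_two hk0.le, ← Real.rpow_natCast k 2, ← Real.rpow_mul hk0.le,
          mul_left_comm, ← Real.rpow_add hk0]
        congr 2
        push_cast
        ring

/-- A nonnegative sequence vanishing up to `N` and dominated by `c * k ^ p` with `p < -1` is
summable, with sum controlled by `N ^ (p + 1)`. -/
theorem summable_and_tsum_le_of_le_rpow {f : ℕ → ℝ} {c p : ℝ} (hc : 0 ≤ c) (hp : p < -1)
    {N : ℕ} (hN : 0 < N) (hf_nonneg : ∀ k, 0 ≤ f k) (hf_le : ∀ k : ℕ, f k ≤ c * (k : ℝ) ^ p)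
    (hf_zero : ∀ k ≤ N, f k = 0) :
    Summable f ∧ ∑' k, f k ≤ c * ((N : ℝ) ^ (p + 1) / (-(p + 1))) := by
  have hg : Summable fun k : ℕ => c * (k : ℝ) ^ p := (Real.summable_nat_rpow.mpr hp).mul_left c
  have hsum : Summable f := hg.of_nonneg_of_le hf_nonneg hf_le
  refine ⟨hsum, ?_⟩
  have hzero : ∑ k ∈ Finset.range (N + 1), f k = 0 := Finset.sum_eq_zero fun k hk =>
    hf_zero k (Nat.lt_succ_iff.mp (Finset.mem_range.mp hk))
  rw [← hsum.sum_add_tsum_nat_add (N + 1), hzero, zero_add]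
  calc ∑' n : ℕ, f (n + (N + 1))
      ≤ ∑' n : ℕ, c * ((n + (N + 1) : ℕ) : ℝ) ^ p :=
        Summable.tsum_le_tsum (fun n => hf_le (n + (N + 1)))
          (hsum.comp_injective (add_left_injective _)) (hg.comp_injective (add_left_injective _))
    _ ≤ c * ((N : ℝ) ^ (p + 1) / (-(p + 1))) := by
        simp only [tsum_mul_left, ← Nat.add_assoc]
        exact mul_le_mul_of_nonneg_left (tsum_natCast_add_rpow_le hp hN) hc

/-- **Weighted spectral sums, high-frequency (elliptic) part.**
For `a, b ≥ 0` with `b - 2a < -1` there is `C > 0` such that for all `λ ≥ 2`,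
`∑_{k ∈ ℕ, k > 2λ} (k² + λ²)^{-a} (1+k)^b ≤ C λ^{b+1-2a}` (and the series converges). -/
theorem weighted_spectral_sum_high
    (a b : ℝ) (ha : 0 ≤ a) (hb : 0 ≤ b) (hab : b - 2 * a < -1) :
    ∃ C : ℝ, 0 < C ∧ ∀ lam : ℝ, 2 ≤ lam →
      Summable (fun k : ℕ =>
        if 2 * lam < (k : ℝ) then ((k : ℝ) ^ 2 + lam ^ 2) ^ (-a) * (1 + (k : ℝ)) ^ b else 0) ∧
      ∑' k : ℕ,
          (if 2 * lam < (k : ℝ) then ((k : ℝ) ^ 2 + lam ^ 2) ^ (-a) * (1 + (k : ℝ)) ^ b else 0)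
        ≤ C * lam ^ (b + 1 - 2 * a) := by
  have hpos : 0 < -(b - 2 * a + 1) := by linarith
  refine ⟨2 ^ b / (-(b - 2 * a + 1)), by positivity, fun lam hlam => ?_⟩
  obtain ⟨N, hN_le, hlam_le⟩ : ∃ N : ℕ, (N : ℝ) ≤ 2 * lam ∧ lam ≤ N :=
    ⟨⌊2 * lam⌋₊, Nat.floor_le (by linarith), by linarith [Nat.lt_floor_add_one (2 * lam)]⟩
  have hN : 0 < N := Nat.cast_pos.mp (by linarith : (0 : ℝ) < N)
  refine (summable_and_tsum_le_of_le_rpow (c := 2 ^ b) (by positivity) hab hN (fun k => ?_)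
    (fun k => ?_) (fun k hk => ?_)).imp_right fun h => h.trans ?_
  · split_ifs <;> positivity
  · split_ifs with h
    · exact weight_le_rpow ha hb (by linarith)
    · positivity
  · have : (k : ℝ) ≤ N := Nat.cast_le.mpr hk
    exact if_neg (by linarith)
  · calc (2 : ℝ) ^ b * ((N : ℝ) ^ (b - 2 * a + 1) / (-(b - 2 * a + 1)))
        ≤ 2 ^ b * (lam ^ (b - 2 * a + 1) / (-(b - 2 * a + 1))) := by
          gcongr 2 ^ b * (?_ / _)
          exact Real.rpow_le_rpow_of_nonpos (by linarith) hlam_le (by linarith)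
      _ = 2 ^ b / (-(b - 2 * a + 1)) * lam ^ (b + 1 - 2 * a) := by
          rw [show b + 1 - 2 * a = b - 2 * a + 1 by ring]
          ring
end

section
/- Let (M, μ) be a σ-finite measure space, let (e_k)_{k∈ℕ} be a Hilbert basis of L²(M), and let (t_k)_{k∈ℕ} be nonnegative real numbers. For a closed interval I ⊂ ℝ, let Π_I denote the orthogonal projection of L²(M) onto the closed linear span of {e_k : t_k ∈ I}. Fix real numbers λ ≥ 1, μ₀ ∈ [1, λ], q ∈ [2, ∞), δ ≥ 0, α ∈ [1, ∞), and C > 0. Assume that for every ℓ of the form ℓ = m·μ₀ with m ∈ ℕ and ℓ ≤ 2λ, every finite orthonormal family (u_j)_{j∈J} contained in the range of Π_{[ℓ, ℓ+μ₀]}, and all nonnegative reals (ν_j)_{j∈J}, one has ‖Σ_{j∈J} ν_j |u_j|²‖_{L^{q/2}(M)} ≤ C λ^{2δ} (Σ_{j∈J} ν_j^α)^{1/α}. Let R be the unique bounded linear operator on L²(M) with R e_k = (t_k² − (λ + i·μ₀)²)^{−1} e_k for all k. Then there is a universal constant K > 0 (independent of M, (e_k), (t_k), λ, μ₀, q, δ,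 α, C and of the data below) such that for every finite orthonormal family (u_j)_{j∈J} in L²(M) and all nonnegative reals (ν_j)_{j∈J}: ‖Σ_{j∈J} ν_j |R Π_{[0,2λ]} u_j|²‖_{L^{q/2}(M)} ≤ K · C · λ^{2δ−2} μ₀^{−2} (Σ_{j∈J} ν_j^α)^{1/α}. -/
open MeasureTheory ENNReal

/-- Jensen's inequality for powers with subunital weights. -/
lemma rpow_sum_mul_le_sum_mul_rpow {ι : Type*} [Fintype ι] {w z : ι → ℝ} (hw : ∀ i, 0 ≤ w i)
    (hw_sum : ∑ i, w i ≤ 1) (hz : ∀ i, 0 ≤ z i) {p : ℝ} (hp : 1 ≤ p) :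
    (∑ i, w i * z i) ^ p ≤ ∑ i, w i * z i ^ p := by
  have h := Real.rpow_arith_mean_le_arith_mean_rpow Finset.univ
    (fun o : Option ι => o.elim (1 - ∑ i, w i) w) (fun o => o.elim 0 z)
    (by rintro (_ | i) _ <;> simp [hw_sum, hw]) (by simp [Fintype.sum_option])
    (by rintro (_ | i) _ <;> simp [hz]) hp
  simpa [Fintype.sum_option, Real.zero_rpow (by positivity : p ≠ 0)] using h

/-- Pythagoras' theorem for a finite orthogonal family. -/
lemma norm_sq_sum_of_inner_eq_zero {E ι : Type*} [NormedAddCommGroup E] [InnerProductSpace ℂ E]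
    [Fintype ι] (x : ι → E) (hx : ∀ k l, k ≠ l → inner ℂ (x k) (x l) = 0) :
    ‖∑ k, x k‖ ^ 2 = ∑ k, ‖x k‖ ^ 2 := by
  have h : inner ℂ (∑ k, x k) (∑ k, x k) = ∑ k, inner ℂ (x k) (x k) := by
    simp_rw [sum_inner, inner_sum]
    exact Finset.sum_congr rfl fun k _ =>
      Finset.sum_eq_single k (fun l _ hl => hx k l hl.symm) (by simp)
  simp_rw [inner_self_eq_norm_sq_to_K] at h
  exact_mod_cast h

/-- Parseval's identity for a Hilbert basis. -/
lemma HilbertBasis.hasSum_norm_inner_sq {ι H : Type*} [NormedAddCommGroup H]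
    [InnerProductSpace ℂ H] (b : HilbertBasis ι ℂ H) (h : H) :
    HasSum (fun k => ‖inner ℂ (b k) h‖ ^ 2) (‖h‖ ^ 2) := by
  have hsum := (b.hasSum_inner_mul_inner h h).mapL Complex.reCLM
  convert hsum using 1
  · ext k
    rw [← inner_conj_symm h (b k), Complex.reCLM_apply, Complex.conj_mul', ← Complex.ofReal_pow,
      Complex.ofReal_re]
  · exact norm_sq_eq_re_inner (𝕜 := ℂ) h

/-- Bounded operators agreeing on a Hilbert basis are equal. -/
lemma HilbertBasis.ext_clm {ι H H' : Type*} [NormedAddCommGroup H] [InnerProductSpace ℂ H]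
    [NormedAddCommGroup H'] [InnerProductSpace ℂ H'] (b : HilbertBasis ι ℂ H) {S T : H →L[ℂ] H'}
    (h : ∀ k, S (b k) = T (b k)) : S = T := by
  refine ContinuousLinearMap.ext_on (s := Set.range b) ?_ (by rintro _ ⟨k, rfl⟩; exact h k)
  rw [dense_iff_closure_eq, ← Submodule.topologicalClosure_coe, b.dense_span]; rfl

section Hilbert

variable {H H' : Type*} [NormedAddCommGroup H] [InnerProductSpace ℂ H] [CompleteSpace H]
  [NormedAddCommGroup H'] [InnerProductSpace ℂ H'] [CompleteSpace H']

/-- A bounded operator restricted to a finite-dimensional subspace maps some orthonormal basis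
of it to an orthogonal family. -/
lemma exists_orthonormalBasis_map_orthogonal (X : H →L[ℂ] H') (U : Submodule ℂ H)
    [FiniteDimensional ℂ U] :
    ∃ φ : OrthonormalBasis (Fin (Module.finrank ℂ U)) ℂ U,
      ∀ k l, k ≠ l → inner ℂ (X (φ k)) (X (φ l)) = 0 := by
  let L : U →L[ℂ] H' := X ∘L U.subtypeL
  have hsymm : ((L.adjoint ∘L L : U →L[ℂ] U) : U →ₗ[ℂ] U).IsSymmetric := fun x y => by
    simp [ContinuousLinearMap.adjoint_inner_left, ContinuousLinearMap.adjoint_inner_right]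
  refine ⟨hsymm.eigenvectorBasis rfl, fun k l hkl => ?_⟩
  have h := hsymm.apply_eigenvectorBasis rfl l
  have h2 : inner ℂ (hsymm.eigenvectorBasis rfl k)
      ((L.adjoint ∘L L) (hsymm.eigenvectorBasis rfl l)) = 0 := by
    rw [← ContinuousLinearMap.coe_coe, h, inner_smul_right,
      (hsymm.eigenvectorBasis rfl).inner_eq_zero hkl, mul_zero]
  simpa [ContinuousLinearMap.adjoint_inner_right, L] using h2

/-- Transfer of a weighted orthonormal family through a bounded operator `X`: by the singular
value decomposition, `∑ ν j ‖X u j‖²` is dominated by a similar expression for the adjoint of `X`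
and an orthonormal family in the range of `X`. -/
lemma exists_orthonormal_sum_norm_sq_le_adjoint (X : H →L[ℂ] H') {ι : Type} [Fintype ι]
    {u : ι → H} (hu : Orthonormal ℂ u) {ν : ι → ℝ} (hν : ∀ j, 0 ≤ ν j) {α : ℝ} (hα : 1 ≤ α) :
    ∃ (κ : Type) (_ : Fintype κ) (f : κ → H') (ω : κ → ℝ), Orthonormal ℂ f ∧
      (∀ k, f k ∈ Set.range X) ∧ (∀ k, 0 ≤ ω k) ∧ ∑ k, ω k ^ α ≤ ∑ j, ν j ^ α ∧
      ∑ j, ν j * ‖X (u j)‖ ^ 2 ≤ ∑ k, ω k * ‖X.adjoint (f k)‖ ^ 2 := by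
  classical
  let U : Submodule ℂ H := Submodule.span ℂ (Set.range u)
  have : FiniteDimensional ℂ U := FiniteDimensional.span_of_finite ℂ (Set.finite_range u)
  obtain ⟨φ, hφ⟩ := exists_orthonormalBasis_map_orthogonal X U
  let κ : Type := {k // X (φ k) ≠ 0}
  let v : κ → H := fun k => φ k.1
  let d : ι → κ → ℝ := fun j k => ‖inner ℂ (v k) (u j)‖ ^ 2
  have hd : ∀ j k, 0 ≤ d j k := fun j k => by positivity
  have hv_norm : ∀ k, ‖v k‖ = 1 := fun k => φ.norm_eq_one k.1
  have hv : Orthonormal ℂ v :=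
    (φ.orthonormal.comp_linearIsometry U.subtypeₗᵢ).comp _ Subtype.val_injective
  have hd_left : ∀ k, ∑ j, d j k ≤ 1 := fun k => by
    have := hu.sum_inner_products_le (s := Finset.univ) (v k)
    simpa [hv_norm, d, norm_inner_symm (v k)] using this
  have hd_right : ∀ j, ∑ k, d j k ≤ 1 := fun j => by
    have := hv.sum_inner_products_le (s := Finset.univ) (u j)
    simpa [hu.1 j, d] using this
  have hX : ∀ j, ‖X (u j)‖ ^ 2 = ∑ k, d j k * ‖X (v k)‖ ^ 2 := fun j => by
    have hmem : u j ∈ U := Submodule.subset_span ⟨j, rfl⟩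
    have hexp : X (u j) = ∑ k, (inner ℂ ((φ k : U) : H) (u j)) • X (φ k) := by
      have h := congrArg (fun z : U => X z) (φ.sum_repr ⟨u j, hmem⟩)
      simpa [φ.repr_apply_apply] using h.symm
    have hsq : ‖X (u j)‖ ^ 2
        = ∑ k, ‖inner ℂ ((φ k : U) : H) (u j)‖ ^ 2 * ‖X (φ k)‖ ^ 2 := by
      rw [hexp, norm_sq_sum_of_inner_eq_zero]
      · simp_rw [norm_smul, mul_pow]
      · intro k l hkl
        rw [inner_smul_left, inner_smul_right, hφ k l hkl, mul_zero, mul_zero]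
    rw [hsq, ← Finset.sum_filter_add_sum_filter_not Finset.univ (fun k => X (φ k) ≠ 0),
      Finset.sum_subtype (p := fun k => X (φ k) ≠ 0) _ (by simp), add_eq_left]
    refine Finset.sum_eq_zero fun k hk => ?_
    have hk0 : X (φ k) = 0 := by simpa using hk
    simp [hk0]
  refine ⟨κ, inferInstance, fun k => ((‖X (v k)‖⁻¹ : ℝ) : ℂ) • X (v k),
    fun k => ∑ j, d j k * ν j, ?_, ?_, ?_, ?_, ?_⟩
  · refine ⟨fun k => ?_, fun k l hkl => ?_⟩
    · have : ‖X (v k)‖ ≠ 0 := norm_ne_zero_iff.2 k.2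
      simp [norm_smul, this]
    · simp [inner_smul_left, inner_smul_right, v, hφ _ _ (Subtype.val_injective.ne hkl)]
  · exact fun k => ⟨((‖X (v k)‖⁻¹ : ℝ) : ℂ) • v k, by simp⟩
  · exact fun k => Finset.sum_nonneg fun j _ => mul_nonneg (hd j k) (hν j)
  · calc ∑ k, (∑ j, d j k * ν j) ^ α ≤ ∑ k, ∑ j, d j k * ν j ^ α :=
          Finset.sum_le_sum fun k _ =>
            rpow_sum_mul_le_sum_mul_rpow (fun j => hd j k) (hd_left k) hν hα
      _ = ∑ j, (∑ k, d j k) * ν j ^ α := by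
          rw [Finset.sum_comm]; simp_rw [Finset.sum_mul]
      _ ≤ ∑ j, ν j ^ α := Finset.sum_le_sum fun j _ =>
          mul_le_of_le_one_left (Real.rpow_nonneg (hν j) _) (hd_right j)
  · have hXv : ∀ k, ‖X (v k)‖ ≤ ‖X.adjoint (((‖X (v k)‖⁻¹ : ℝ) : ℂ) • X (v k))‖ := fun k => by
      have hne : ‖X (v k)‖ ≠ 0 := norm_ne_zero_iff.2 k.2
      have h := norm_inner_le_norm (𝕜 := ℂ) (X.adjoint (((‖X (v k)‖⁻¹ : ℝ) : ℂ) • X (v k))) (v k)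
      rw [ContinuousLinearMap.adjoint_inner_left, inner_smul_left, inner_self_eq_norm_sq_to_K,
        hv_norm, mul_one] at h
      refine le_of_eq_of_le ?_ h
      simp
      field_simp
    calc ∑ j, ν j * ‖X (u j)‖ ^ 2 = ∑ k, (∑ j, d j k * ν j) * ‖X (v k)‖ ^ 2 := by
          simp_rw [hX, Finset.mul_sum, Finset.sum_mul]
          rw [Finset.sum_comm]
          exact Finset.sum_congr rfl fun k _ => Finset.sum_congr rfl fun j _ => by ring
      _ ≤ _ := Finset.sum_le_sum fun k _ => mul_le_mul_of_nonneg_left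
          (pow_le_pow_left₀ (norm_nonneg _) (hXv k) 2)
          (Finset.sum_nonneg fun j _ => mul_nonneg (hd j k) (hν j))

/-- If `A` is dominated by orthogonal-type pieces `P m` in the sense
`‖A* h‖² ≤ ∑ c m ‖P m h‖²`, weighted bounds for families in the ranges of the `P m` add up to a
weighted bound for `A`. -/
lemma sum_norm_sq_comp_le_of_adjoint_le {β : Type*} (s : Finset β) (A : H →L[ℂ] H)
    (P : β → H →L[ℂ] H) (hP : ∀ m, (P m).adjoint = P m)
    (hP_idem : ∀ m x, P m (P m x) = P m x) (c : β → ℝ) (hc : ∀ m, 0 ≤ c m)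
    (hA : ∀ h, ‖A.adjoint h‖ ^ 2 ≤ ∑ m ∈ s, c m * ‖P m h‖ ^ 2) (W : H →L[ℂ] H')
    {ι : Type} [Fintype ι] {u : ι → H} (hu : Orthonormal ℂ u) {ν : ι → ℝ} (hν : ∀ j, 0 ≤ ν j)
    {α B : ℝ} (hα : 1 ≤ α)
    (hB : ∀ m ∈ s, ∀ (κ : Type) [Fintype κ] (g : κ → H), Orthonormal ℂ g →
      (∀ k, g k ∈ Set.range (P m)) → ∀ ω : κ → ℝ, (∀ k, 0 ≤ ω k) →
      ∑ k, ω k ^ α ≤ ∑ j, ν j ^ α → ∑ k, ω k * ‖W (g k)‖ ^ 2 ≤ B) :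
    ∑ j, ν j * ‖W (A (u j))‖ ^ 2 ≤ (∑ m ∈ s, c m) * B := by
  obtain ⟨κ, _, f, ω, hf, -, hω, hων, hle⟩ :=
    exists_orthonormal_sum_norm_sq_le_adjoint (W ∘L A) hu hν hα
  have hpiece : ∀ m ∈ s, ∑ k, ω k * ‖P m (W.adjoint (f k))‖ ^ 2 ≤ B := fun m hm => by
    obtain ⟨κ', _, g, ω', hg, hgr, hω', hων', hle'⟩ :=
      exists_orthonormal_sum_norm_sq_le_adjoint (P m ∘L W.adjoint) hf hω hα
    have hgP : ∀ k, g k ∈ Set.range (P m) := fun k => by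
      obtain ⟨y, hy⟩ := hgr k
      exact ⟨W.adjoint y, hy⟩
    have hPP : ∀ k, P m (g k) = g k := fun k => by
      obtain ⟨y, hy⟩ := hgP k
      rw [← hy, hP_idem]
    refine hle'.trans (le_of_eq_of_le ?_ (hB m hm κ' g hg hgP ω' hω' (hων'.trans hων)))
    simp [ContinuousLinearMap.adjoint_comp, hP, hPP]
  calc ∑ j, ν j * ‖W (A (u j))‖ ^ 2
      ≤ ∑ k, ω k * ‖A.adjoint (W.adjoint (f k))‖ ^ 2 := by
        simpa [ContinuousLinearMap.adjoint_comp] using hle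
    _ ≤ ∑ k, ω k * ∑ m ∈ s, c m * ‖P m (W.adjoint (f k))‖ ^ 2 := by
        gcongr with k _
        · exact hω k
        · exact hA _
    _ = ∑ m ∈ s, c m * ∑ k, ω k * ‖P m (W.adjoint (f k))‖ ^ 2 := by
        simp_rw [Finset.mul_sum]
        rw [Finset.sum_comm]
        exact Finset.sum_congr rfl fun m _ => Finset.sum_congr rfl fun k _ => by ring
    _ ≤ ∑ m ∈ s, c m * B := by
        gcongr with m hm
        · exact hc m
        · exact hpiece m hm
    _ = (∑ m ∈ s, c m) * B := by rw [Finset.sum_mul]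

lemma inner_adjoint_of_apply_eq_smul {D : H →L[ℂ] H} {v : H} {z : ℂ} (hD : D v = z • v) (h : H) :
    inner ℂ v (D.adjoint h) = starRingEnd ℂ z * inner ℂ v h := by
  rw [ContinuousLinearMap.adjoint_inner_right, hD, inner_smul_left]

lemma HilbertBasis.adjoint_eq_self_of_diagonal {ι : Type*} (b : HilbertBasis ι ℂ H)
    {D : H →L[ℂ] H} (d : ι → ℝ) (hD : ∀ k, D (b k) = (d k : ℂ) • b k) : D.adjoint = D := by
  classical
  refine b.ext_clm fun k => b.repr.injective ?_
  ext j
  rw [b.repr_apply_apply, b.repr_apply_apply, inner_adjoint_of_apply_eq_smul (hD j), hD k,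
    inner_smul_right, orthonormal_iff_ite.1 b.orthonormal]
  split_ifs with hjk <;> simp [hjk]

lemma HilbertBasis.norm_adjoint_sq_le_of_diagonal {ι β : Type*} (b : HilbertBasis ι ℂ H)
    (s : Finset β) {A : H →L[ℂ] H} {a : ι → ℂ} (hA : ∀ k, A (b k) = a k • b k)
    {P : β → H →L[ℂ] H} {p : β → ι → ℂ} (hP : ∀ m k, P m (b k) = p m k • b k) {c : β → ℝ}
    (h_le : ∀ k, ‖a k‖ ^ 2 ≤ ∑ m ∈ s, c m * ‖p m k‖ ^ 2) (h : H) :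
    ‖A.adjoint h‖ ^ 2 ≤ ∑ m ∈ s, c m * ‖(P m).adjoint h‖ ^ 2 := by
  refine hasSum_le (fun k => ?_) (b.hasSum_norm_inner_sq (A.adjoint h))
    (hasSum_sum fun m _ => (b.hasSum_norm_inner_sq ((P m).adjoint h)).mul_left (c m))
  simp_rw [inner_adjoint_of_apply_eq_smul (hA k), inner_adjoint_of_apply_eq_smul (hP _ k),
    norm_mul, mul_pow, RCLike.norm_conj, ← mul_assoc]
  rw [← Finset.sum_mul]
  exact mul_le_mul_of_nonneg_right (h_le k) (by positivity)

end Hilbert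

section Measure

variable {M : Type*} [MeasurableSpace M] {μ : Measure M}

/-- Multiplication by a bounded measurable function as a bounded operator on `L²`. -/
lemma exists_clm_coeFn_eq_mul {w : M → ℝ} (hw : Measurable w) {N : ℝ} (hN : ∀ x, |w x| ≤ N) :
    ∃ W : Lp ℂ 2 μ →L[ℂ] Lp ℂ 2 μ, ∀ f : Lp ℂ 2 μ, W f =ᵐ[μ] fun x => (w x : ℂ) * f x := by
  have hmem : MemLp (fun x => (w x : ℂ)) ∞ μ :=
    memLp_top_of_bound (Complex.measurable_ofReal.comp hw).aestronglyMeasurable N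
      (.of_forall fun x => by simpa using hN x)
  refine ⟨(ContinuousLinearMap.mul ℂ ℂ).holderL μ ∞ 2 2 (hmem.toLp _), fun f => ?_⟩
  filter_upwards [(ContinuousLinearMap.mul ℂ ℂ).coeFn_holder (r := 2) (hmem.toLp _) f,
    hmem.coeFn_toLp] with x hx hwx
  simp [hx, hwx]

lemma lintegral_norm_sq_eq (f : Lp ℂ 2 μ) :
    ∫⁻ x, ENNReal.ofReal (‖f x‖ ^ 2) ∂μ = ENNReal.ofReal (‖f‖ ^ 2) := by
  have h := eLpNorm_nnreal_pow_eq_lintegral (f := f) (μ := μ) (p := 2) (by norm_num)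
  rw [ENNReal.ofReal_pow (norm_nonneg _), ofReal_norm, Lp.enorm_def]
  simp_rw [ENNReal.ofReal_pow (norm_nonneg _), ofReal_norm]
  simpa using h.symm

/-- Weighted integrals of densities are weighted sums of squared norms. -/
lemma lintegral_mul_density_eq {ι : Type*} [Fintype ι] {w : M → ℝ}
    {W : Lp ℂ 2 μ →L[ℂ] Lp ℂ 2 μ} (hW : ∀ f : Lp ℂ 2 μ, W f =ᵐ[μ] fun x => (w x : ℂ) * f x)
    (v : ι → Lp ℂ 2 μ) {ν : ι → ℝ} (hν : ∀ j, 0 ≤ ν j) :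
    ∫⁻ x, ENNReal.ofReal (w x ^ 2 * ∑ j, ν j * ‖v j x‖ ^ 2) ∂μ
      = ENNReal.ofReal (∑ j, ν j * ‖W (v j)‖ ^ 2) := by
  have hae : ∀ᵐ x ∂μ, ∀ j, W (v j) x = (w x : ℂ) * v j x := ae_all_iff.2 fun j => hW (v j)
  calc ∫⁻ x, ENNReal.ofReal (w x ^ 2 * ∑ j, ν j * ‖v j x‖ ^ 2) ∂μ
      = ∫⁻ x, ∑ j, ENNReal.ofReal (ν j) * ENNReal.ofReal (‖W (v j) x‖ ^ 2) ∂μ := by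
        refine lintegral_congr_ae ?_
        filter_upwards [hae] with x hx
        simp_rw [← ENNReal.ofReal_mul (hν _)]
        rw [← ENNReal.ofReal_sum_of_nonneg fun j _ => mul_nonneg (hν j) (by positivity),
          Finset.mul_sum]
        congr 1
        refine Finset.sum_congr rfl fun j _ => ?_
        rw [hx j, norm_mul, mul_pow, Complex.norm_real, Real.norm_eq_abs, sq_abs]
        ring
    _ = ENNReal.ofReal (∑ j, ν j * ‖W (v j)‖ ^ 2) := by
        have hmeas : ∀ j, Measurable fun x => ENNReal.ofReal (‖W (v j) x‖ ^ 2) := fun j =>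
          ((Lp.stronglyMeasurable (W (v j))).measurable.norm.pow_const 2).ennreal_ofReal
        rw [lintegral_finsetSum _ fun j _ => (hmeas j).const_mul _,
          ENNReal.ofReal_sum_of_nonneg fun j _ => mul_nonneg (hν j) (by positivity)]
        refine Finset.sum_congr rfl fun j _ => ?_
        rw [lintegral_const_mul _ (hmeas j), lintegral_norm_sq_eq, ENNReal.ofReal_mul (hν j)]

lemma eLpNorm_ofReal_eq_lintegral {ρ : M → ℝ} (hρ : ∀ x, 0 ≤ ρ x) {p : ℝ} (hp : 1 ≤ p) :
    eLpNorm ρ (ENNReal.ofReal p) μ = (∫⁻ x, ENNReal.ofReal (ρ x) ^ p ∂μ) ^ (1 / p) := by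
  have hp0 : 0 < p := by positivity
  rw [eLpNorm_eq_lintegral_rpow_enorm_toReal (by simpa using hp0) ENNReal.ofReal_ne_top,
    ENNReal.toReal_ofReal hp0.le]
  simp_rw [Real.enorm_of_nonneg (hρ _)]

/-- Hölder's inequality in the form `∫ g^(p-1) ρ ≤ ‖ρ‖_p (∫ g^p)^(1-1/p)`. -/
lemma lintegral_rpow_mul_le_eLpNorm {g ρ : M → ℝ} (hg : Measurable g) (hg0 : ∀ x, 0 ≤ g x)
    (hρ : Measurable ρ) (hρ0 : ∀ x, 0 ≤ ρ x) {p : ℝ} (hp : 1 ≤ p) :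
    ∫⁻ x, ENNReal.ofReal (g x ^ (p - 1) * ρ x) ∂μ
      ≤ (∫⁻ x, ENNReal.ofReal (g x) ^ p ∂μ) ^ (1 - 1 / p) * eLpNorm ρ (ENNReal.ofReal p) μ := by
  have hp0 : 0 < p := by positivity
  have hp1 : 1 / p ≤ 1 := by rw [div_le_one hp0]; exact hp
  have h := ENNReal.lintegral_mul_norm_pow_le (μ := μ)
    (f := fun x => ENNReal.ofReal (g x) ^ p) (g := fun x => ENNReal.ofReal (ρ x) ^ p)
    (hg.ennreal_ofReal.pow_const p).aemeasurable (hρ.ennreal_ofReal.pow_const p).aemeasurable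
    (sub_nonneg.2 hp1) (by positivity : 0 ≤ 1 / p) (by ring)
  rw [eLpNorm_ofReal_eq_lintegral hρ0 hp]
  refine le_of_eq_of_le (lintegral_congr fun x => ?_) h
  rw [← ENNReal.rpow_mul, ← ENNReal.rpow_mul, mul_one_div_cancel hp0.ne', ENNReal.rpow_one,
    ENNReal.ofReal_mul (Real.rpow_nonneg (hg0 x) _),
    ← ENNReal.ofReal_rpow_of_nonneg (hg0 x) (sub_nonneg.2 hp), mul_one_sub,
    mul_one_div_cancel hp0.ne']

/-- Converse of Hölder's inequality, tested on bounded functions. -/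
lemma eLpNorm_le_of_forall_lintegral_le {ρ : M → ℝ} (hρ : Measurable ρ) (hρ0 : ∀ x, 0 ≤ ρ x)
    (hint : ∫⁻ x, ENNReal.ofReal (ρ x) ∂μ ≠ ∞) {p : ℝ} (hp : 1 ≤ p) {D : ℝ≥0∞}
    (h : ∀ g : M → ℝ, Measurable g → (∀ x, 0 ≤ g x) → (∃ N, ∀ x, g x ≤ N) →
      ∫⁻ x, ENNReal.ofReal (g x) ^ p ∂μ ≠ ∞ →
      ∫⁻ x, ENNReal.ofReal (g x ^ (p - 1) * ρ x) ∂μ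
        ≤ (∫⁻ x, ENNReal.ofReal (g x) ^ p ∂μ) ^ (1 - 1 / p) * D) :
    eLpNorm ρ (ENNReal.ofReal p) μ ≤ D := by
  have hp0 : 0 < p := by positivity
  rw [eLpNorm_ofReal_eq_lintegral hρ0 hp]
  have htrunc : ∀ n : ℕ, ∫⁻ x, ENNReal.ofReal (min (ρ x) n) ^ p ∂μ ≤ D ^ p := fun n => by
    have hg : Measurable fun x => min (ρ x) n := hρ.min measurable_const
    have hg0 : ∀ x, 0 ≤ min (ρ x) n := fun x => le_min (hρ0 x) n.cast_nonneg
    have hle : ∀ x, ENNReal.ofReal (min (ρ x) n) ^ p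
        ≤ ENNReal.ofReal (min (ρ x) n ^ (p - 1) * ρ x) := fun x => by
      rw [ENNReal.ofReal_rpow_of_nonneg (hg0 x) hp0.le]
      refine ENNReal.ofReal_le_ofReal ?_
      calc min (ρ x) n ^ p = min (ρ x) n ^ (p - 1) * min (ρ x) n := by
            rw [← Real.rpow_add_one' (hg0 x) (by simpa using hp0.ne'), sub_add_cancel]
        _ ≤ min (ρ x) n ^ (p - 1) * ρ x :=
            mul_le_mul_of_nonneg_left (min_le_left _ _) (Real.rpow_nonneg (hg0 x) _)
    have hfin : ∫⁻ x, ENNReal.ofReal (min (ρ x) n) ^ p ∂μ ≠ ∞ := by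
      refine ne_top_of_le_ne_top (b := ENNReal.ofReal ((n : ℝ) ^ (p - 1)) *
        ∫⁻ x, ENNReal.ofReal (ρ x) ∂μ) (ENNReal.mul_ne_top ENNReal.ofReal_ne_top hint) ?_
      rw [← lintegral_const_mul _ hρ.ennreal_ofReal]
      refine lintegral_mono fun x => (hle x).trans ?_
      rw [ENNReal.ofReal_mul (Real.rpow_nonneg (hg0 x) _)]
      gcongr
      · exact hg0 x
      exact min_le_right _ _
    have hmain := (lintegral_mono hle).trans
      (h _ hg hg0 ⟨n, fun x => min_le_right _ _⟩ hfin)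
    generalize ∫⁻ x, ENNReal.ofReal (min (ρ x) n) ^ p ∂μ = Z at hfin hmain
    rcases eq_or_ne Z 0 with rfl | hZ
    · exact zero_le
    have hZsplit : Z = Z ^ (1 - 1 / p) * Z ^ (1 / p) := by
      rw [← ENNReal.rpow_add _ _ hZ hfin, sub_add_cancel, ENNReal.rpow_one]
    have hpow0 : Z ^ (1 - 1 / p) ≠ 0 := (ENNReal.rpow_pos (pos_iff_ne_zero.2 hZ) hfin).ne'
    have hpowtop : Z ^ (1 - 1 / p) ≠ ∞ := ENNReal.rpow_ne_top_of_ne_zero hZ hfin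
    rw [← ENNReal.rpow_inv_le_iff hp0, ← one_div]
    exact (ENNReal.mul_le_mul_iff_right hpow0 hpowtop).1 (hZsplit.symm.trans_le hmain)
  rw [one_div, ENNReal.rpow_inv_le_iff hp0]
  have hsup : ∀ x, ENNReal.ofReal (ρ x) ^ p
      = ⨆ n : ℕ, ENNReal.ofReal (min (ρ x) n) ^ p := fun x => by
    refine le_antisymm ?_ (iSup_le fun n => by gcongr; exact min_le_left _ _)
    obtain ⟨n, hn⟩ := exists_nat_ge (ρ x)
    refine le_iSup_of_le n ?_
    rw [min_eq_left hn]
  simp_rw [hsup]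
  rw [lintegral_iSup (fun n => (hρ.min measurable_const).ennreal_ofReal.pow_const p)]
  · exact iSup_le htrunc
  · intro m n hmn x
    dsimp only
    gcongr

lemma measurable_density {ι : Type*} [Fintype ι] (v : ι → Lp ℂ 2 μ) (ν : ι → ℝ) :
    Measurable fun x => ∑ j, ν j * ‖v j x‖ ^ 2 :=
  Finset.measurable_fun_sum _ fun j _ =>
    ((Lp.stronglyMeasurable (v j)).measurable.norm.pow_const 2).const_mul _

lemma lintegral_density_ne_top {ι : Type*} [Fintype ι] (v : ι → Lp ℂ 2 μ) {ν : ι → ℝ}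
    (hν : ∀ j, 0 ≤ ν j) : ∫⁻ x, ENNReal.ofReal (∑ j, ν j * ‖v j x‖ ^ 2) ∂μ ≠ ∞ := by
  have h := lintegral_mul_density_eq (μ := μ) (w := fun _ => 1)
    (W := ContinuousLinearMap.id ℂ _) (fun f => by simp) v hν
  simp only [one_pow, one_mul] at h
  exact h ▸ ENNReal.ofReal_ne_top

end Measure
section Numerics

/-- Elementary lower bound for the resolvent symbol. -/
lemma norm_inv_sq_sub_sq_sq_le {t lam mu0 : ℝ} (ht : 0 ≤ t) (hlam : 0 < lam) (hmu : 0 < mu0) :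
    ‖((t : ℂ) ^ 2 - ((lam : ℂ) + Complex.I * (mu0 : ℂ)) ^ 2)⁻¹‖ ^ 2
      ≤ (lam ^ 2 * ((t - lam) ^ 2 + mu0 ^ 2))⁻¹ := by
  have hfac : (t : ℂ) ^ 2 - ((lam : ℂ) + Complex.I * (mu0 : ℂ)) ^ 2
      = (⟨t - lam, -mu0⟩ : ℂ) * (⟨t + lam, mu0⟩ : ℂ) := by
    apply Complex.ext <;> simp [pow_two] <;> ring
  rw [hfac, norm_inv, inv_pow, norm_mul, mul_pow, ← Complex.normSq_eq_norm_sq,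
    ← Complex.normSq_eq_norm_sq, Complex.normSq_mk, Complex.normSq_mk]
  have : 0 < (t - lam) ^ 2 + mu0 ^ 2 := by positivity
  refine inv_anti₀ (by positivity) ?_
  nlinarith [mul_nonneg ht hlam.le, sq_nonneg t, sq_nonneg mu0]

lemma summable_inv_one_add_int_sq : Summable fun d : ℤ => (1 + (d : ℝ) ^ 2)⁻¹ := by
  have h := (Real.summable_one_div_int_add_rpow (1 / 2) 2).2 (by norm_num)
  refine Summable.of_nonneg_of_le (fun d => by positivity) (fun d => ?_) (h.mul_left 2)
  have hpos : (0 : ℝ) < |(d : ℝ) + 1 / 2| := by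
    refine abs_pos.2 fun h0 => ?_
    have : (2 * d + 1 : ℤ) = 0 := by exact_mod_cast (by linarith : (2 * d + 1 : ℝ) = 0)
    omega
  rw [Real.rpow_two, sq_abs, mul_one_div, inv_eq_one_div, div_le_div_iff₀ (by positivity)
    (by rw [← sq_abs]; positivity)]
  nlinarith [sq_nonneg ((d : ℝ) - 1 / 2)]

/-- A unit-scale discretisation of `1 / ((s - L)² + 1)`. -/
lemma inv_sq_add_one_le {s L : ℝ} {m : ℕ} (hm : (m : ℝ) ≤ s) (hm' : s ≤ m + 1) :
    ((s - L) ^ 2 + 1)⁻¹ ≤ 3 * (1 + (((m : ℤ) - ⌊L⌋ : ℤ) : ℝ) ^ 2)⁻¹ := by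
  have h1 := Int.floor_le L
  have h2 := Int.lt_floor_add_one L
  push_cast
  generalize (⌊L⌋ : ℝ) = n at *
  rw [← div_eq_mul_inv, inv_eq_one_div, div_le_div_iff₀ (by positivity) (by positivity)]
  have he : ((m - n) - (s - L)) ^ 2 ≤ 1 := (sq_le_one_iff_abs_le_one _).2
    (abs_le.2 ⟨by linarith, by linarith⟩)
  nlinarith [sq_nonneg ((s - L) - ((m - n) - (s - L))), sq_nonneg (s - L)]

/-- The squared size of the resolvent symbol on the `m`-th cluster, up to a universal constant. -/
noncomputable def clusterWeight (lam mu0 : ℝ) (m : ℕ) : ℝ :=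
  (lam ^ 2 * mu0 ^ 2)⁻¹ * (3 * (1 + (((m : ℤ) - ⌊lam / mu0⌋ : ℤ) : ℝ) ^ 2)⁻¹)

lemma clusterWeight_nonneg (lam mu0 : ℝ) (m : ℕ) : 0 ≤ clusterWeight lam mu0 m := by
  unfold clusterWeight
  positivity

lemma sum_clusterWeight_le (lam mu0 : ℝ) (s : Finset ℕ) :
    ∑ m ∈ s, clusterWeight lam mu0 m
      ≤ (lam ^ 2 * mu0 ^ 2)⁻¹ * (3 * ∑' d : ℤ, (1 + (d : ℝ) ^ 2)⁻¹) := by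
  unfold clusterWeight
  rw [← Finset.mul_sum, ← Finset.mul_sum]
  have hinj : Function.Injective fun m : ℕ => (m : ℤ) - ⌊lam / mu0⌋ := fun m n h => by
    simpa using h
  have hle := (summable_inv_one_add_int_sq.comp_injective hinj).sum_le_tsum s
    fun m _ => by simp only [Function.comp_apply]; positivity
  have htsum := tsum_comp_le_tsum_of_inj summable_inv_one_add_int_sq
    (fun d => by positivity) hinj
  gcongr
  exact hle.trans htsum

/-- On `[0, 2λ]` the squared resolvent symbol is dominated by the cluster weights. -/
lemma norm_resolvent_sq_le_sum_clusterWeight {t lam mu0 : ℝ} (hlam : 0 < lam) (hmu : 0 < mu0)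
    (ht : t ∈ Set.Icc 0 (2 * lam)) :
    ‖((t : ℂ) ^ 2 - ((lam : ℂ) + Complex.I * (mu0 : ℂ)) ^ 2)⁻¹‖ ^ 2
      ≤ ∑ m ∈ Finset.range (⌊2 * lam / mu0⌋₊ + 1), clusterWeight lam mu0 m *
        (Set.Icc ((m : ℝ) * mu0) (m * mu0 + mu0)).indicator 1 t := by
  have hs0 : 0 ≤ t / mu0 := div_nonneg ht.1 hmu.le
  have hm := Nat.floor_le hs0
  have hm' := (Nat.lt_floor_add_one (t / mu0)).le
  have hmem : t ∈ Set.Icc ((⌊t / mu0⌋₊ : ℝ) * mu0) (⌊t / mu0⌋₊ * mu0 + mu0) := by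
    refine ⟨(le_div_iff₀ hmu).1 hm, ?_⟩
    rw [div_le_iff₀ hmu] at hm'
    linarith
  have hrange : ⌊t / mu0⌋₊ ∈ Finset.range (⌊2 * lam / mu0⌋₊ + 1) := by
    rw [Finset.mem_range, Nat.lt_succ_iff]
    exact Nat.floor_le_floor (div_le_div_of_nonneg_right ht.2 hmu.le)
  calc ‖((t : ℂ) ^ 2 - ((lam : ℂ) + Complex.I * (mu0 : ℂ)) ^ 2)⁻¹‖ ^ 2
      ≤ (lam ^ 2 * ((t - lam) ^ 2 + mu0 ^ 2))⁻¹ := norm_inv_sq_sub_sq_sq_le ht.1 hlam hmu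
    _ = (lam ^ 2 * mu0 ^ 2)⁻¹ * ((t / mu0 - lam / mu0) ^ 2 + 1)⁻¹ := by
        rw [← mul_inv]
        congr 1
        field_simp
    _ ≤ clusterWeight lam mu0 ⌊t / mu0⌋₊ := by
        unfold clusterWeight
        gcongr
        exact inv_sq_add_one_le hm hm'
    _ = clusterWeight lam mu0 ⌊t / mu0⌋₊ *
        (Set.Icc ((⌊t / mu0⌋₊ : ℝ) * mu0) (⌊t / mu0⌋₊ * mu0 + mu0)).indicator 1 t := by
        simp [Set.indicator_of_mem hmem]
    _ ≤ _ := Finset.single_le_sum (f := fun m : ℕ => clusterWeight lam mu0 m *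
        (Set.Icc ((m : ℝ) * mu0) (m * mu0 + mu0)).indicator 1 t)
        (fun m _ => mul_nonneg (clusterWeight_nonneg _ _ _)
          (Set.indicator_nonneg (fun _ _ => zero_le_one) _)) hrange

end Numerics

/-- **Spectral cluster bounds imply resolvent-density bounds.**
Let `(e k)` be a Hilbert basis of `L²(M)` with nonnegative "frequencies" `t k`, let
`Proj I` denote the orthogonal projection onto the closed span of `{e k : t k ∈ I}`
(characterised by its action on the basis), and let `R` be the (unique) bounded operator
with `R (e k) = (t k² − (λ + i μ₀)²)⁻¹ e k`.  If the cluster bound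
`‖∑ j ν j |u_j|²‖_{L^{q/2}} ≤ C λ^{2δ} (∑ j ν j^α)^{1/α}` holds for all finite orthonormal
families in the range of `Proj [ℓ, ℓ+μ₀]`, `ℓ = m μ₀ ≤ 2λ`, then there is a universal
constant `K > 0` such that
`‖∑ j ν j |R Π_{[0,2λ]} u_j|²‖_{L^{q/2}} ≤ K C λ^{2δ−2} μ₀^{−2} (∑ j ν j^α)^{1/α}`
for every finite orthonormal family `(u j)` and nonnegative `(ν j)`. -/
theorem cluster_bounds_imply_resolvent_density_bounds :
    ∃ K : ℝ, 0 < K ∧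
      ∀ (M : Type) [MeasurableSpace M] (μ : Measure M) [SigmaFinite μ]
        (b : HilbertBasis ℕ ℂ (Lp ℂ 2 μ))
        (t : ℕ → ℝ), (∀ k, 0 ≤ t k) →
        ∀ (lam mu0 q δ α C : ℝ),
        1 ≤ lam → 1 ≤ mu0 → mu0 ≤ lam → 2 ≤ q → 0 ≤ δ → 1 ≤ α → 0 < C →
        ∀ (Proj : Set ℝ → (Lp ℂ 2 μ →L[ℂ] Lp ℂ 2 μ)),
        (∀ (I : Set ℝ) (k : ℕ), (t k ∈ I → Proj I (b k) = b k) ∧ (t k ∉ I → Proj I (b k) = 0)) →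
        ∀ (R : Lp ℂ 2 μ →L[ℂ] Lp ℂ 2 μ),
        (∀ k : ℕ, R (b k)
            = (((t k : ℂ)) ^ 2 - ((lam : ℂ) + Complex.I * (mu0 : ℂ)) ^ 2)⁻¹ • b k) →
        (∀ (m : ℕ), (m : ℝ) * mu0 ≤ 2 * lam →
          ∀ (ι : Type) [Fintype ι] (u : ι → Lp ℂ 2 μ), Orthonormal ℂ u →
          (∀ j, u j ∈ Set.range (Proj (Set.Icc ((m : ℝ) * mu0) ((m : ℝ) * mu0 + mu0)))) →
          ∀ (ν : ι → ℝ), (∀ j, 0 ≤ ν j) →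
          eLpNorm (fun x => ∑ j, ν j * ‖(u j) x‖ ^ 2) (ENNReal.ofReal (q / 2)) μ
            ≤ ENNReal.ofReal (C * lam ^ (2 * δ) * (∑ j, ν j ^ α) ^ (1 / α))) →
        ∀ (ι : Type) [Fintype ι] (u : ι → Lp ℂ 2 μ), Orthonormal ℂ u →
        ∀ (ν : ι → ℝ), (∀ j, 0 ≤ ν j) →
        eLpNorm (fun x => ∑ j, ν j * ‖(R (Proj (Set.Icc 0 (2 * lam)) (u j))) x‖ ^ 2)
            (ENNReal.ofReal (q / 2)) μ
          ≤ ENNReal.ofReal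
              (K * C * lam ^ (2 * δ - 2) * mu0 ^ (-2 : ℝ) * (∑ j, ν j ^ α) ^ (1 / α)) := by
  refine ⟨3 * ∑' d : ℤ, (1 + (d : ℝ) ^ 2)⁻¹, ?_, ?_⟩
  · have := summable_inv_one_add_int_sq.tsum_pos (fun d => by positivity) 0 (by norm_num)
    positivity
  intro M _ μ _ b t ht lam mu0 q δ α C hlam hmu _ hq _ hα hC Proj hProj R hR hcluster
    ι _ u hu ν hν
  have hlam0 : 0 < lam := by linarith
  have hmu0 : 0 < mu0 := by linarith
  have hp : 1 ≤ q / 2 := by linarith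
  have hdiag : ∀ I k, Proj I (b k) = ((I.indicator 1 (t k) : ℝ) : ℂ) • b k := fun I k => by
    by_cases hk : t k ∈ I
    · simp [hk, (hProj I k).1 hk]
    · simp [hk, (hProj I k).2 hk]
  have hself : ∀ I, (Proj I).adjoint = Proj I := fun I =>
    b.adjoint_eq_self_of_diagonal _ (hdiag I)
  have hidem : ∀ I x, Proj I (Proj I x) = Proj I x := fun I x => by
    refine DFunLike.congr_fun (b.ext_clm (S := Proj I ∘L Proj I) (T := Proj I) fun k => ?_) x
    by_cases hk : t k ∈ I
    · simp [(hProj I k).1 hk]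
    · simp [(hProj I k).2 hk]
  let I : ℕ → Set ℝ := fun m => Set.Icc ((m : ℝ) * mu0) (m * mu0 + mu0)
  let s := Finset.range (⌊2 * lam / mu0⌋₊ + 1)
  let A := R ∘L Proj (Set.Icc 0 (2 * lam))
  have hA : ∀ h, ‖A.adjoint h‖ ^ 2
      ≤ ∑ m ∈ s, clusterWeight lam mu0 m * ‖Proj (I m) h‖ ^ 2 := fun h => by
    have hAdiag : ∀ k, A (b k) = (((Set.Icc 0 (2 * lam)).indicator 1 (t k) : ℝ) *
        ((t k : ℂ) ^ 2 - ((lam : ℂ) + Complex.I * (mu0 : ℂ)) ^ 2)⁻¹) • b k := fun k => by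
      simp only [A, ContinuousLinearMap.comp_apply, hdiag, map_smul, hR, smul_smul]
    have hle := b.norm_adjoint_sq_le_of_diagonal s hAdiag (fun m k => hdiag (I m) k)
      (c := clusterWeight lam mu0) (fun k => ?_) h
    · simpa only [hself] using hle
    have hsq : ∀ m, ‖(((I m).indicator 1 (t k) : ℝ) : ℂ)‖ ^ 2 = (I m).indicator 1 (t k) :=
      fun m => by by_cases hk : t k ∈ I m <;> simp [hk]
    simp_rw [hsq]
    by_cases hk : t k ∈ Set.Icc 0 (2 * lam)
    · simpa [Set.indicator_of_mem hk] using norm_resolvent_sq_le_sum_clusterWeight hlam0 hmu0 hk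
    · rw [Set.indicator_of_notMem hk, Complex.ofReal_zero, zero_mul, norm_zero,
        zero_pow two_ne_zero]
      exact Finset.sum_nonneg fun m _ => mul_nonneg (clusterWeight_nonneg _ _ _)
        (Set.indicator_nonneg (fun _ _ => zero_le_one) _)
  have hN : 0 ≤ ∑ j, ν j ^ α := Finset.sum_nonneg fun j _ => Real.rpow_nonneg (hν j) _
  set B : ℝ := C * lam ^ (2 * δ) * (∑ j, ν j ^ α) ^ (1 / α) with hB
  have hB0 : 0 ≤ B := by positivity
  have hdens0 : ∀ {κ : Type} [Fintype κ] (v : κ → Lp ℂ 2 μ) (ω : κ → ℝ), (∀ k, 0 ≤ ω k) →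
      ∀ x, 0 ≤ ∑ k, ω k * ‖v k x‖ ^ 2 := fun v ω hω x =>
    Finset.sum_nonneg fun k _ => mul_nonneg (hω k) (by positivity)
  have hbound : eLpNorm (fun x => ∑ j, ν j * ‖(A (u j)) x‖ ^ 2) (ENNReal.ofReal (q / 2)) μ
      ≤ ENNReal.ofReal ((∑ m ∈ s, clusterWeight lam mu0 m) * B) := by
    refine eLpNorm_le_of_forall_lintegral_le (measurable_density _ ν) (hdens0 _ ν hν)
      (lintegral_density_ne_top _ hν) hp fun g hg hg0 ⟨N, hgN⟩ hZ => ?_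
    set Z := (∫⁻ x, ENNReal.ofReal (g x) ^ (q / 2) ∂μ) ^ (1 - 1 / (q / 2)) with hZdef
    have hZtop : Z ≠ ∞ := ENNReal.rpow_ne_top_of_nonneg
      (sub_nonneg.2 ((div_le_one (by linarith)).2 hp)) hZ
    obtain ⟨W, hW⟩ := exists_clm_coeFn_eq_mul (μ := μ) (w := fun x => g x ^ ((q / 2 - 1) / 2))
      (N := N ^ ((q / 2 - 1) / 2)) (hg.pow_const _) fun x => by
        rw [abs_of_nonneg (Real.rpow_nonneg (hg0 x) _)]
        exact Real.rpow_le_rpow (hg0 x) (hgN x) (by linarith)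
    have hwsq : ∀ x, (g x ^ ((q / 2 - 1) / 2)) ^ 2 = g x ^ (q / 2 - 1) := fun x => by
      rw [← Real.rpow_mul_natCast (hg0 x)]
      congr 1
      push_cast
      ring
    have hint : ∀ {κ : Type} [Fintype κ] (v : κ → Lp ℂ 2 μ) (ω : κ → ℝ), (∀ k, 0 ≤ ω k) →
        ∫⁻ x, ENNReal.ofReal (g x ^ (q / 2 - 1) * ∑ k, ω k * ‖v k x‖ ^ 2) ∂μ
          = ENNReal.ofReal (∑ k, ω k * ‖W (v k)‖ ^ 2) := fun v ω hω => by
      rw [← lintegral_mul_density_eq hW v hω]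
      simp_rw [hwsq]
    rw [hint _ ν hν]
    have hsum := sum_norm_sq_comp_le_of_adjoint_le s A (fun m => Proj (I m))
      (fun m => hself _) (fun m => hidem _) (clusterWeight lam mu0) (clusterWeight_nonneg _ _) hA W
      hu hν (B := Z.toReal * B) hα fun m hm κ _ v hv hvr ω hω hων => by
        have hm' : (m : ℝ) * mu0 ≤ 2 * lam := by
          rw [← le_div_iff₀ hmu0, ← Nat.le_floor_iff (by positivity)]
          exact Nat.lt_succ_iff.1 (Finset.mem_range.1 hm)
        have hω0 : 0 ≤ ∑ k, ω k ^ α := Finset.sum_nonneg fun k _ => Real.rpow_nonneg (hω k) _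
        rw [← ENNReal.ofReal_le_ofReal_iff (by positivity), ← hint v ω hω,
          ENNReal.ofReal_mul ENNReal.toReal_nonneg, ENNReal.ofReal_toReal hZtop]
        refine (lintegral_rpow_mul_le_eLpNorm hg hg0 (measurable_density v ω)
          (hdens0 v ω hω) hp).trans ?_
        gcongr
        refine (hcluster m hm' κ v hv hvr ω hω).trans (ENNReal.ofReal_le_ofReal ?_)
        rw [hB]
        gcongr
    refine (ENNReal.ofReal_le_ofReal hsum).trans_eq ?_
    rw [mul_left_comm, ENNReal.ofReal_mul ENNReal.toReal_nonneg, ENNReal.ofReal_toReal hZtop]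
  refine hbound.trans (ENNReal.ofReal_le_ofReal ?_)
  refine (mul_le_mul_of_nonneg_right (sum_clusterWeight_le lam mu0 s) hB0).trans_eq ?_
  rw [hB, Real.rpow_sub hlam0, Real.rpow_neg hmu0.le, Real.rpow_two, Real.rpow_two]
  field_simp
end

section
/- Let n ≥ 1 and let a, b : ℝⁿ → Sym(n, ℝ) be bounded measurable maps into the real symmetric n×n matrices, with a uniformly elliptic: there is c > 0 such that ⟨a(x)ξ, ξ⟩ ≥ c|ξ|² for all x ∈ ℝⁿ and ξ ∈ ℝⁿ. Let w, v : ℝⁿ → ℝ be measurable with w(x) > 0 for all x, and suppose the essential supremum norms ‖a − b‖_∞ := ess sup_x |a(x) − b(x)| (matrix operator norm), ‖b‖_∞, and ‖1 − v/w‖_∞ are finite. Define the quadratic forms Q_a(u) := ∫_{ℝⁿ} ⟨a(x) ∇u(x), ∇u(x)⟩ w(x) dx and Q_b(u) := ∫_{ℝⁿ} ⟨b(x) ∇u(x), ∇u(x)⟩ v(x) dx, where for complex-valued u, ⟨a∇u, ∇u⟩ := Σ_{i,j} a^{ij} ∂_i ū ∂_j u. Then for every u ∈ C_c^∞(ℝⁿ;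 ℂ): |Q_a(u) − Q_b(u)| ≤ c^{−1} ( ‖a − b‖_∞ + ‖b‖_∞ ‖1 − v/w‖_∞ ) · Q_a(u). -/
open MeasureTheory ENNReal

/-- The quadratic (sesquilinear) form `Q(f,g) = ∫ ∑_{i,j} aᵢⱼ ∂ᵢf̄ ∂ⱼg · w dx` associated to a
matrix-valued coefficient map `a` and a weight `w`. -/
noncomputable def quadForm (n : ℕ) (a : (Fin n → ℝ) → Matrix (Fin n) (Fin n) ℝ)
    (w : (Fin n → ℝ) → ℝ) (f g : (Fin n → ℝ) → ℂ) : ℂ :=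
  ∫ x, (∑ i, ∑ j, (a x i j : ℂ) *
      (starRingEnd ℂ) (fderiv ℝ f x (Pi.single i 1)) *
        (fderiv ℝ g x (Pi.single j 1))) * (w x : ℂ)

/-- For a real symmetric matrix, the Hermitian form at `z` is the sum of the real quadratic forms
at the real and imaginary parts of `z`. -/
theorem Matrix.IsSymm.sum_conj_mul_eq {n : ℕ} {A : Matrix (Fin n) (Fin n) ℝ} (hA : A.IsSymm)
    (z : Fin n → ℂ) :
    ∑ i, ∑ j, (A i j : ℂ) * (starRingEnd ℂ) (z i) * z j =
      ((∑ i, ∑ j, A i j * (z i).re * (z j).re + ∑ i, ∑ j, A i j * (z i).im * (z j).im : ℝ) : ℂ) := by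
  apply Complex.ext
  · simp only [Complex.re_sum, Complex.ofReal_re, ← Finset.sum_add_distrib]
    refine Finset.sum_congr rfl fun i _ => Finset.sum_congr rfl fun j _ => ?_
    simp
  · have hswap : ∑ i, ∑ j, A i j * (z i).im * (z j).re = ∑ i, ∑ j, A i j * (z i).re * (z j).im := by
      rw [Finset.sum_comm]
      refine Finset.sum_congr rfl fun i _ => Finset.sum_congr rfl fun j _ => ?_
      rw [hA.apply i j]
      ring
    rw [Complex.ofReal_im, ← sub_eq_zero.mpr hswap.symm]
    simp only [Complex.im_sum, ← Finset.sum_sub_distrib]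
    refine Finset.sum_congr rfl fun i _ => Finset.sum_congr rfl fun j _ => ?_
    simp
    ring

/-- A real quadratic form is bounded by the operator norm of its matrix. -/
theorem Matrix.abs_sum_mul_mul_le_norm_toEuclideanCLM {n : ℕ} (A : Matrix (Fin n) (Fin n) ℝ)
    (ξ : Fin n → ℝ) :
    |∑ i, ∑ j, A i j * ξ i * ξ j| ≤ ‖Matrix.toEuclideanCLM (𝕜 := ℝ) A‖ * ∑ i, ξ i ^ 2 := by
  set y : EuclideanSpace ℝ (Fin n) := WithLp.toLp 2 ξ
  have hinner : ∑ i, ∑ j, A i j * ξ i * ξ j =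
      inner ℝ y (Matrix.toEuclideanCLM (𝕜 := ℝ) A y) := by
    simp only [PiLp.inner_apply, RCLike.inner_apply, conj_trivial, y, Matrix.toEuclideanCLM_toLp,
      Matrix.mulVec, dotProduct, Finset.sum_mul]
    refine Finset.sum_congr rfl fun i _ => Finset.sum_congr rfl fun j _ => ?_
    ring
  have hnorm : ∑ i, ξ i ^ 2 = ‖y‖ * ‖y‖ := by
    rw [← sq, EuclideanSpace.real_norm_sq_eq]
  rw [hinner, hnorm]
  calc |inner ℝ y (Matrix.toEuclideanCLM (𝕜 := ℝ) A y)|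
      ≤ ‖y‖ * ‖Matrix.toEuclideanCLM (𝕜 := ℝ) A y‖ := abs_real_inner_le_norm _ _
    _ ≤ ‖y‖ * (‖Matrix.toEuclideanCLM (𝕜 := ℝ) A‖ * ‖y‖) := by
        gcongr
        exact ContinuousLinearMap.le_opNorm _ _
    _ = _ := by ring

/-- The Hermitian form of a real symmetric matrix is bounded by its operator norm. -/
theorem Matrix.IsSymm.norm_sum_conj_mul_le {n : ℕ} {A : Matrix (Fin n) (Fin n) ℝ} (hA : A.IsSymm)
    (z : Fin n → ℂ) :
    ‖∑ i, ∑ j, (A i j : ℂ) * (starRingEnd ℂ) (z i) * z j‖ ≤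
      ‖Matrix.toEuclideanCLM (𝕜 := ℝ) A‖ * (∑ i, (z i).re ^ 2 + ∑ i, (z i).im ^ 2) := by
  rw [hA.sum_conj_mul_eq, Complex.norm_real, Real.norm_eq_abs, mul_add]
  exact (abs_add_le _ _).trans (add_le_add
    (A.abs_sum_mul_mul_le_norm_toEuclideanCLM fun i => (z i).re)
    (A.abs_sum_mul_mul_le_norm_toEuclideanCLM fun i => (z i).im))

/-- A function is almost everywhere bounded in norm by its finite essential supremum. -/
theorem ae_norm_le_toReal_essSup {α E : Type*} [MeasurableSpace α] {μ : Measure α}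
    [SeminormedAddCommGroup E] {f : α → E}
    (hf : essSup (fun x => (‖f x‖₊ : ℝ≥0∞)) μ ≠ ∞) :
    ∀ᵐ x ∂μ, ‖f x‖ ≤ (essSup (fun x => (‖f x‖₊ : ℝ≥0∞)) μ).toReal := by
  filter_upwards [ENNReal.ae_le_essSup (μ := μ) fun x => (‖f x‖₊ : ℝ≥0∞)] with x hx
  simpa using ENNReal.toReal_mono hf hx

/-- Pointwise comparison of two weighted Hermitian forms with real symmetric coefficients, the
first of which is elliptic. -/
theorem Matrix.norm_weighted_form_sub_le {n : ℕ} {A B : Matrix (Fin n) (Fin n) ℝ}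
    (hA : A.IsSymm) (hB : B.IsSymm) {c : ℝ} (hc : 0 < c)
    (hell : ∀ ξ : Fin n → ℝ, c * ∑ i, ξ i ^ 2 ≤ ∑ i, ∑ j, A i j * ξ i * ξ j)
    {s t α β γ : ℝ} (hs : 0 < s) (hα : ‖Matrix.toEuclideanCLM (𝕜 := ℝ) (A - B)‖ ≤ α)
    (hβ : ‖Matrix.toEuclideanCLM (𝕜 := ℝ) B‖ ≤ β) (hγ : ‖1 - t / s‖ ≤ γ) (z : Fin n → ℂ) :
    ‖(∑ i, ∑ j, (A i j : ℂ) * (starRingEnd ℂ) (z i) * z j) * (s : ℂ) -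
        (∑ i, ∑ j, (B i j : ℂ) * (starRingEnd ℂ) (z i) * z j) * (t : ℂ)‖ ≤
      c⁻¹ * (α + β * γ) *
        ((∑ i, ∑ j, (A i j : ℂ) * (starRingEnd ℂ) (z i) * z j) * (s : ℂ)).re := by
  set R := ∑ i, (z i).re ^ 2 + ∑ i, (z i).im ^ 2 with hR
  have hR0 : 0 ≤ R := by positivity
  have hα0 : 0 ≤ α := (norm_nonneg _).trans hα
  have hβ0 : 0 ≤ β := (norm_nonneg _).trans hβ
  have hγ0 : 0 ≤ γ := (norm_nonneg _).trans hγ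
  have hlower : c * R ≤ (∑ i, ∑ j, (A i j : ℂ) * (starRingEnd ℂ) (z i) * z j).re := by
    rw [hA.sum_conj_mul_eq, Complex.ofReal_re, hR, mul_add]
    exact add_le_add (hell fun i => (z i).re) (hell fun i => (z i).im)
  have hdiff := (hA.sub hB).norm_sum_conj_mul_le z
  have hBz := hB.norm_sum_conj_mul_le z
  have hsplit : ∑ i, ∑ j, ((A - B) i j : ℂ) * (starRingEnd ℂ) (z i) * z j =
      ∑ i, ∑ j, (A i j : ℂ) * (starRingEnd ℂ) (z i) * z j -
        ∑ i, ∑ j, (B i j : ℂ) * (starRingEnd ℂ) (z i) * z j := by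
    simp only [← Finset.sum_sub_distrib, Matrix.sub_apply, Complex.ofReal_sub, sub_mul]
  rw [hsplit] at hdiff
  rw [Complex.re_mul_ofReal]
  set SA := ∑ i, ∑ j, (A i j : ℂ) * (starRingEnd ℂ) (z i) * z j
  set SB := ∑ i, ∑ j, (B i j : ℂ) * (starRingEnd ℂ) (z i) * z j
  have hs' : (s : ℂ) ≠ 0 := by exact_mod_cast hs.ne'
  have hfactor : SA * (s : ℂ) - SB * (t : ℂ) =
      ((SA - SB) + SB * ((1 - t / s : ℝ) : ℂ)) * (s : ℂ) := by
    push_cast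
    field_simp
    ring
  calc ‖SA * (s : ℂ) - SB * (t : ℂ)‖
      = ‖(SA - SB) + SB * ((1 - t / s : ℝ) : ℂ)‖ * s := by
        rw [hfactor, norm_mul, Complex.norm_real, Real.norm_of_nonneg hs.le]
    _ ≤ (α * R + β * R * γ) * s := by
        gcongr
        refine (norm_add_le _ _).trans (add_le_add (hdiff.trans (by gcongr)) ?_)
        rw [norm_mul, Complex.norm_real]
        have := hBz.trans (mul_le_mul_of_nonneg_right hβ hR0)
        gcongr
    _ = c⁻¹ * (α + β * γ) * (c * R * s) := by
        field_simp
    _ ≤ c⁻¹ * (α + β * γ) * (SA.re * s) := by gcongr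

/-- **Comparison of quadratic forms with nearby coefficients.**
If `a` is uniformly elliptic with constant `c`, `b` is close to `a` and `v/w` is close to `1`
in `L^∞`, then `|Q_a(u) − Q_b(u)| ≤ c⁻¹ (‖a−b‖_∞ + ‖b‖_∞ ‖1 − v/w‖_∞) Q_a(u)` for all
`u ∈ C_c^∞(ℝⁿ; ℂ)`, where `‖·‖_∞` denotes essential suprema (matrix operator norms). -/
theorem quadratic_form_comparison
    (n : ℕ) (hn : 1 ≤ n)
    (a b : (Fin n → ℝ) → Matrix (Fin n) (Fin n) ℝ)
    (ha_meas : ∀ i j, Measurable fun x => a x i j)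
    (hb_meas : ∀ i j, Measurable fun x => b x i j)
    (ha_bdd : ∃ C, ∀ x i j, |a x i j| ≤ C) (hb_bdd : ∃ C, ∀ x i j, |b x i j| ≤ C)
    (ha_symm : ∀ x, (a x).IsSymm) (hb_symm : ∀ x, (b x).IsSymm)
    (c : ℝ) (hc : 0 < c)
    (h_ell : ∀ x (ξ : Fin n → ℝ),
      c * ∑ i, ξ i ^ 2 ≤ ∑ i, ∑ j, a x i j * ξ i * ξ j)
    (w v : (Fin n → ℝ) → ℝ)
    (hw_meas : Measurable w) (hv_meas : Measurable v)
    (hw_pos : ∀ x, 0 < w x)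
    (Nab Nb Nv : ℝ≥0∞)
    (hNab : Nab = essSup
      (fun x => (‖Matrix.toEuclideanCLM (𝕜 := ℝ) (a x - b x)‖₊ : ℝ≥0∞)) volume)
    (hNb : Nb = essSup
      (fun x => (‖Matrix.toEuclideanCLM (𝕜 := ℝ) (b x)‖₊ : ℝ≥0∞)) volume)
    (hNv : Nv = essSup (fun x => (‖1 - v x / w x‖₊ : ℝ≥0∞)) volume)
    (hNab_fin : Nab ≠ ∞) (hNb_fin : Nb ≠ ∞) (hNv_fin : Nv ≠ ∞)
    (u : (Fin n → ℝ) → ℂ) (hu : ContDiff ℝ (⊤ : ℕ∞) u) (hu_supp : HasCompactSupport u)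
    -- the two quadratic forms are well defined:
    (hQa : MeasureTheory.Integrable (fun x => (∑ i, ∑ j, (a x i j : ℂ) *
      (starRingEnd ℂ) (fderiv ℝ u x (Pi.single i 1)) *
        (fderiv ℝ u x (Pi.single j 1))) * (w x : ℂ)))
    (hQb : MeasureTheory.Integrable (fun x => (∑ i, ∑ j, (b x i j : ℂ) *
      (starRingEnd ℂ) (fderiv ℝ u x (Pi.single i 1)) *
        (fderiv ℝ u x (Pi.single j 1))) * (v x : ℂ))) :
    ‖quadForm n a w u u - quadForm n b v u u‖
      ≤ c⁻¹ * (Nab.toReal + Nb.toReal * Nv.toReal) * ‖quadForm n a w u u‖ := by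
  have hpoint : ∀ᵐ x, ‖(∑ i, ∑ j, (a x i j : ℂ) *
      (starRingEnd ℂ) (fderiv ℝ u x (Pi.single i 1)) *
        (fderiv ℝ u x (Pi.single j 1))) * (w x : ℂ) - (∑ i, ∑ j, (b x i j : ℂ) *
      (starRingEnd ℂ) (fderiv ℝ u x (Pi.single i 1)) *
        (fderiv ℝ u x (Pi.single j 1))) * (v x : ℂ)‖ ≤
      c⁻¹ * (Nab.toReal + Nb.toReal * Nv.toReal) * ((∑ i, ∑ j, (a x i j : ℂ) *
      (starRingEnd ℂ) (fderiv ℝ u x (Pi.single i 1)) *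
        (fderiv ℝ u x (Pi.single j 1))) * (w x : ℂ)).re := by
    subst hNab hNb hNv
    filter_upwards [ae_norm_le_toReal_essSup hNab_fin, ae_norm_le_toReal_essSup hNb_fin,
      ae_norm_le_toReal_essSup hNv_fin] with x hab hb hv
    exact Matrix.norm_weighted_form_sub_le (ha_symm x) (hb_symm x) hc (h_ell x) (hw_pos x)
      hab hb hv fun i => fderiv ℝ u x (Pi.single i 1)
  unfold quadForm
  rw [← integral_sub hQa hQb]
  refine (norm_integral_le_of_norm_le (hQa.re.const_mul _) hpoint).trans ?_
  rw [integral_const_mul]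
  refine mul_le_mul_of_nonneg_left ?_ (by positivity)
  exact (integral_re hQa).trans_le (Complex.re_le_norm _)
end

section
/- Let n ≥ 1 and let a : ℝⁿ → Sym(n, ℝ) be a bounded measurable map into the real symmetric positive semidefinite n×n matrices, and let w : ℝⁿ → (0, ∞) be bounded measurable. Define the sesquilinear form Q(f, g) := ∫_{ℝⁿ} Σ_{i,j} a^{ij}(x) ∂_i f̄(x) ∂_j g(x) w(x) dx and write Q(u) := Q(u, u). Let φ ∈ C^∞(ℝⁿ; ℝ) have bounded derivatives of all orders, and set M := ess sup_x ⟨a(x)∇φ(x), ∇φ(x)⟩^{1/2}. Then for every u ∈ C_c^∞(ℝⁿ; ℂ): |Q(u, φu) − Q(φu, u)| ≤ 2 M ‖u‖_{L²(w dx)} · Q(u)^{1/2}, where ‖u‖_{L²(w dx)}² = ∫ |u|² w dx. -/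
open MeasureTheory ENNReal

/-- **Cauchy–Schwarz** for a symmetric positive semidefinite real matrix. -/
theorem sq_sum_sum_mul_le {ι : Type*} [Fintype ι] {A : Matrix ι ι ℝ} (hA : A.IsSymm)
    (hpsd : ∀ ξ : ι → ℝ, 0 ≤ ∑ i, ∑ j, A i j * ξ i * ξ j) (p q : ι → ℝ) :
    (∑ i, ∑ j, A i j * p i * q j) ^ 2 ≤
      (∑ i, ∑ j, A i j * p i * p j) * ∑ i, ∑ j, A i j * q i * q j := by
  classical
  have key (x y : ι → ℝ) : Matrix.toBilin' A x y = ∑ i, ∑ j, A i j * x i * y j := by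
    rw [Matrix.toBilin'_apply]
    exact Finset.sum_congr rfl fun i _ => Finset.sum_congr rfl fun j _ => by ring
  have hsymm : LinearMap.IsSymm (Matrix.toBilin' A) := by
    refine ⟨fun x y => ?_⟩
    rw [RingHom.id_apply, key, key, Finset.sum_comm]
    refine Finset.sum_congr rfl fun i _ => Finset.sum_congr rfl fun j _ => ?_
    rw [hA.apply]
    ring
  have := LinearMap.BilinForm.apply_sq_le_of_symm (Matrix.toBilin' A)
    (fun x => by rw [key]; exact hpsd x) hsymm p q
  simpa only [key] using this

/-- The Hermitian extension of a real symmetric form splits into real and imaginary parts. -/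
theorem sum_sum_mul_conj_mul_eq_ofReal {ι : Type*} [Fintype ι] {A : Matrix ι ι ℝ}
    (hA : A.IsSymm) (z : ι → ℂ) :
    ∑ i, ∑ j, (A i j : ℂ) * (starRingEnd ℂ) (z i) * z j =
      ((∑ i, ∑ j, A i j * (z i).re * (z j).re + ∑ i, ∑ j, A i j * (z i).im * (z j).im : ℝ) : ℂ) := by
  have hswap : ∑ i, ∑ j, A i j * (z i).im * (z j).re = ∑ i, ∑ j, A i j * (z i).re * (z j).im := by
    rw [Finset.sum_comm]
    refine Finset.sum_congr rfl fun i _ => Finset.sum_congr rfl fun j _ => ?_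
    rw [hA.apply]
    ring
  apply Complex.ext
  · simp only [Complex.re_sum, Complex.ofReal_re, ← Finset.sum_add_distrib]
    refine Finset.sum_congr rfl fun i _ => Finset.sum_congr rfl fun j _ => ?_
    simp [Complex.mul_re, Complex.mul_im]
  · rw [Complex.ofReal_im, ← sub_eq_zero.2 hswap.symm]
    simp only [Complex.im_sum, ← Finset.sum_sub_distrib]
    refine Finset.sum_congr rfl fun i _ => Finset.sum_congr rfl fun j _ => ?_
    simp [Complex.mul_re, Complex.mul_im]
    ring

theorem re_sum_sum_mul_conj_mul_nonneg {ι : Type*} [Fintype ι] {A : Matrix ι ι ℝ}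
    (hA : A.IsSymm) (hpsd : ∀ ξ : ι → ℝ, 0 ≤ ∑ i, ∑ j, A i j * ξ i * ξ j) (z : ι → ℂ) :
    0 ≤ (∑ i, ∑ j, (A i j : ℂ) * (starRingEnd ℂ) (z i) * z j).re := by
  rw [sum_sum_mul_conj_mul_eq_ofReal hA, Complex.ofReal_re]
  exact add_nonneg (hpsd _) (hpsd _)

/-- **Cauchy–Schwarz** for a symmetric positive semidefinite real matrix, between a real and a
complex vector. -/
theorem norm_sum_sum_mul_le {ι : Type*} [Fintype ι] {A : Matrix ι ι ℝ} (hA : A.IsSymm)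
    (hpsd : ∀ ξ : ι → ℝ, 0 ≤ ∑ i, ∑ j, A i j * ξ i * ξ j) (p : ι → ℝ) (z : ι → ℂ) :
    ‖∑ i, ∑ j, (A i j : ℂ) * p i * z j‖ ≤
      √(∑ i, ∑ j, A i j * p i * p j) *
        √(∑ i, ∑ j, (A i j : ℂ) * (starRingEnd ℂ) (z i) * z j).re := by
  rw [← Real.sqrt_mul (hpsd p), sum_sum_mul_conj_mul_eq_ofReal hA, Complex.ofReal_re]
  apply Real.le_sqrt_of_sq_le
  have hre : (∑ i, ∑ j, (A i j : ℂ) * p i * z j).re = ∑ i, ∑ j, A i j * p i * (z j).re := by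
    simp [Complex.re_sum, Complex.mul_re, Complex.mul_im]
  have him : (∑ i, ∑ j, (A i j : ℂ) * p i * z j).im = ∑ i, ∑ j, A i j * p i * (z j).im := by
    simp [Complex.im_sum, Complex.mul_re, Complex.mul_im]
  rw [Complex.sq_norm, Complex.normSq_apply, hre, him, mul_add, ← sq, ← sq]
  exact add_le_add (sq_sum_sum_mul_le hA hpsd _ _) (sq_sum_sum_mul_le hA hpsd _ _)

/-- The pointwise commutator estimate: the zeroth order multiples of `z` cancel. -/
theorem norm_sum_sum_commutator_le {ι : Type*} [Fintype ι] {A : Matrix ι ι ℝ} (hA : A.IsSymm)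
    (hpsd : ∀ ξ : ι → ℝ, 0 ≤ ∑ i, ∑ j, A i j * ξ i * ξ j) (p : ι → ℝ) (z : ι → ℂ) (t : ℝ)
    (c : ℂ) :
    ‖∑ i, ∑ j, (A i j : ℂ) * (starRingEnd ℂ) (z i) * (t * z j + p j * c) -
        ∑ i, ∑ j, (A i j : ℂ) * (starRingEnd ℂ) (t * z i + p i * c) * z j‖ ≤
      2 * √(∑ i, ∑ j, A i j * p i * p j) * (‖c‖ *
        √(∑ i, ∑ j, (A i j : ℂ) * (starRingEnd ℂ) (z i) * z j).re) := by
  set s := ∑ i, ∑ j, (A i j : ℂ) * p i * z j with hs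
  have hconj : (starRingEnd ℂ) s = ∑ i, ∑ j, (A i j : ℂ) * (starRingEnd ℂ) (z i) * p j := by
    rw [Finset.sum_comm]
    simp only [hs, map_sum, map_mul, Complex.conj_ofReal]
    refine Finset.sum_congr rfl fun i _ => Finset.sum_congr rfl fun j _ => ?_
    rw [hA.apply]
    ring
  have hdiff : ∑ i, ∑ j, (A i j : ℂ) * (starRingEnd ℂ) (z i) * (t * z j + p j * c) -
        ∑ i, ∑ j, (A i j : ℂ) * (starRingEnd ℂ) (t * z i + p i * c) * z j =
      (starRingEnd ℂ) s * c - s * (starRingEnd ℂ) c := by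
    rw [hconj, hs]
    simp only [Finset.sum_mul, ← Finset.sum_sub_distrib, map_add, map_mul, Complex.conj_ofReal]
    refine Finset.sum_congr rfl fun i _ => Finset.sum_congr rfl fun j _ => ?_
    ring
  rw [hdiff]
  calc ‖(starRingEnd ℂ) s * c - s * (starRingEnd ℂ) c‖
      ≤ ‖(starRingEnd ℂ) s * c‖ + ‖s * (starRingEnd ℂ) c‖ := norm_sub_le _ _
    _ = 2 * ‖c‖ * ‖s‖ := by simp only [norm_mul, RCLike.norm_conj]; ring
    _ ≤ 2 * ‖c‖ * _ := mul_le_mul_of_nonneg_left (norm_sum_sum_mul_le hA hpsd p z) (by positivity)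
    _ = _ := by ring

/-- Weighted **Cauchy–Schwarz** inequality, in the form `∫ f √E w ≤ (∫ f² w)^{1/2} (∫ E w)^{1/2}`. -/
theorem integral_mul_sqrt_mul_le {α : Type*} [MeasurableSpace α] {μ : Measure α}
    {f E w : α → ℝ} (hf0 : ∀ x, 0 ≤ f x) (hE0 : ∀ x, 0 ≤ E x) (hw0 : ∀ x, 0 ≤ w x)
    (hf : Integrable (fun x => f x ^ 2 * w x) μ) (hE : Integrable (fun x => E x * w x) μ) :
    Integrable (fun x => f x * √(E x) * w x) μ ∧
      ∫ x, f x * √(E x) * w x ∂μ ≤ √(∫ x, f x ^ 2 * w x ∂μ) * √(∫ x, E x * w x ∂μ) := by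
  have hf_sq (x) : √(f x ^ 2 * w x) ^ 2 = f x ^ 2 * w x :=
    Real.sq_sqrt (mul_nonneg (sq_nonneg _) (hw0 x))
  have hE_sq (x) : √(E x * w x) ^ 2 = E x * w x := Real.sq_sqrt (mul_nonneg (hE0 x) (hw0 x))
  have hsplit (x) : √(f x ^ 2 * w x) * √(E x * w x) = f x * √(E x) * w x := by
    rw [Real.sqrt_mul (sq_nonneg _), Real.sqrt_mul (hE0 x), Real.sqrt_sq (hf0 x),
      mul_mul_mul_comm, Real.mul_self_sqrt (hw0 x)]
  have hf_mem : MemLp (fun x => √(f x ^ 2 * w x)) 2 μ :=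
    (memLp_two_iff_integrable_sq
      (Real.continuous_sqrt.comp_aestronglyMeasurable hf.aestronglyMeasurable)).2
      (by simpa only [hf_sq] using hf)
  have hE_mem : MemLp (fun x => √(E x * w x)) 2 μ :=
    (memLp_two_iff_integrable_sq
      (Real.continuous_sqrt.comp_aestronglyMeasurable hE.aestronglyMeasurable)).2
      (by simpa only [hE_sq] using hE)
  constructor
  · simpa only [Pi.mul_def, hsplit] using hf_mem.integrable_mul hE_mem
  · have h2 : ENNReal.ofReal 2 = 2 := by simp
    have := integral_mul_le_Lp_mul_Lq_of_nonneg Real.HolderConjugate.two_two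
      (Filter.Eventually.of_forall fun x => Real.sqrt_nonneg (f x ^ 2 * w x))
      (Filter.Eventually.of_forall fun x => Real.sqrt_nonneg (E x * w x))
      (h2.symm ▸ hf_mem) (h2.symm ▸ hE_mem)
    simpa only [Real.rpow_two, ← Real.sqrt_eq_rpow, hf_sq, hE_sq, hsplit] using this

theorem integrable_norm_sq_mul {n : ℕ} {u : (Fin n → ℝ) → ℂ} (hu : Continuous u)
    (hu_supp : HasCompactSupport u) {w : (Fin n → ℝ) → ℝ} (hw_meas : Measurable w)
    (hw_bdd : ∃ C, ∀ x, |w x| ≤ C) : Integrable fun x => ‖u x‖ ^ 2 * w x := by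
  obtain ⟨D, hD⟩ := hw_bdd
  refine Integrable.mul_bdd (c := D) ?_ hw_meas.aestronglyMeasurable
    (Filter.Eventually.of_forall hD)
  simp only [sq]
  exact (hu.norm.mul hu.norm).integrable_of_hasCompactSupport hu_supp.norm.mul_right

theorem fderiv_ofReal_mul_apply {F : Type*} [NormedAddCommGroup F] [NormedSpace ℝ F]
    {φ : F → ℝ} {u : F → ℂ} {x : F} (hφ : DifferentiableAt ℝ φ x) (hu : DifferentiableAt ℝ u x)
    (v : F) : fderiv ℝ (fun x => (φ x : ℂ) * u x) x v =
      φ x * fderiv ℝ u x v + (fderiv ℝ φ x v : ℂ) * u x := by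
  have h1 : HasFDerivAt (fun x => (φ x : ℂ)) (Complex.ofRealCLM.comp (fderiv ℝ φ x)) x :=
    Complex.ofRealCLM.hasFDerivAt.comp x hφ.hasFDerivAt
  rw [(h1.fun_mul hu.hasFDerivAt).fderiv]
  simp [mul_comm]

/-- The integrand of `quadForm` is integrable when the first argument is compactly supported. -/
theorem integrable_quadForm_integrand {n : ℕ}
    {a : (Fin n → ℝ) → Matrix (Fin n) (Fin n) ℝ}
    (ha_meas : ∀ i j, Measurable fun x => a x i j) (ha_bdd : ∃ C, ∀ x i j, |a x i j| ≤ C)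
    {w : (Fin n → ℝ) → ℝ} (hw_meas : Measurable w) (hw_bdd : ∃ C, ∀ x, |w x| ≤ C)
    {f g : (Fin n → ℝ) → ℂ} (hf : ContDiff ℝ 1 f) (hg : ContDiff ℝ 1 g)
    (hf_supp : HasCompactSupport f) :
    Integrable fun x => (∑ i, ∑ j, (a x i j : ℂ) *
      (starRingEnd ℂ) (fderiv ℝ f x (Pi.single i 1)) *
        (fderiv ℝ g x (Pi.single j 1))) * (w x : ℂ) := by
  obtain ⟨C, hC⟩ := ha_bdd
  obtain ⟨D, hD⟩ := hw_bdd
  have hderiv {h : (Fin n → ℝ) → ℂ} (hh : ContDiff ℝ 1 h) (v : Fin n → ℝ) :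
      Continuous fun x => fderiv ℝ h x v :=
    (hh.continuous_fderiv one_ne_zero).clm_apply continuous_const
  refine Integrable.mul_bdd (c := D) ?_
    (Complex.measurable_ofReal.comp hw_meas).aestronglyMeasurable
    (Filter.Eventually.of_forall fun x => by simpa using hD x)
  refine integrable_finsetSum _ fun i _ => integrable_finsetSum _ fun j _ => ?_
  simp only [mul_assoc]
  refine Integrable.bdd_mul (c := C) ?_
    (Complex.measurable_ofReal.comp (ha_meas i j)).aestronglyMeasurable
    (Filter.Eventually.of_forall fun x => by simpa using hC x i j)
  refine Continuous.integrable_of_hasCompactSupport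
    ((Complex.continuous_conj.comp (hderiv hf _)).mul (hderiv hg _)) ?_
  exact ((hf_supp.fderiv_apply ℝ _).comp_left (map_zero (starRingEnd ℂ))).mul_right

/-- The coefficient length `⟨a ∇φ, ∇φ⟩^{1/2}` is bounded when `a` and `∇φ` are. -/
theorem exists_sqrt_sum_sum_fderiv_le {n : ℕ} {a : (Fin n → ℝ) → Matrix (Fin n) (Fin n) ℝ}
    (ha_bdd : ∃ C, ∀ x i j, |a x i j| ≤ C) {φ : (Fin n → ℝ) → ℝ}
    (hφ_bdd : ∃ C, ∀ x, ‖fderiv ℝ φ x‖ ≤ C) :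
    ∃ K, ∀ x, √(∑ i, ∑ j, a x i j *
      (fderiv ℝ φ x (Pi.single i 1)) * (fderiv ℝ φ x (Pi.single j 1))) ≤ K := by
  obtain ⟨C, hC⟩ := ha_bdd
  obtain ⟨D, hD⟩ := hφ_bdd
  have hpart (x : Fin n → ℝ) (i : Fin n) : |fderiv ℝ φ x (Pi.single i 1)| ≤ D := by
    refine ((fderiv ℝ φ x).le_opNorm _).trans ?_
    simpa [Pi.norm_single] using hD x
  refine ⟨√(∑ _i : Fin n, ∑ _j : Fin n, C * D * D), fun x => Real.sqrt_le_sqrt ?_⟩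
  refine Finset.sum_le_sum fun i _ => Finset.sum_le_sum fun j _ => (le_abs_self _).trans ?_
  have hC0 : 0 ≤ C := (abs_nonneg _).trans (hC x i j)
  have hD0 : 0 ≤ D := (abs_nonneg _).trans (hpart x i)
  rw [abs_mul, abs_mul]
  gcongr
  exacts [hC x i j, hpart x i, hpart x j]

/-- **Commutator form bound.**
For a bounded measurable positive-semidefinite symmetric coefficient map `a`, a bounded
measurable positive weight `w`, and `φ ∈ C^∞(ℝⁿ; ℝ)` with bounded derivatives of all orders,
setting `M := ess sup ⟨a ∇φ, ∇φ⟩^{1/2}`, one has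
`|Q(u, φu) − Q(φu, u)| ≤ 2 M ‖u‖_{L²(w dx)} Q(u)^{1/2}` for every `u ∈ C_c^∞(ℝⁿ; ℂ)`. -/
theorem commutator_form_bound
    (n : ℕ) (hn : 1 ≤ n)
    (a : (Fin n → ℝ) → Matrix (Fin n) (Fin n) ℝ)
    (ha_meas : ∀ i j, Measurable fun x => a x i j)
    (ha_bdd : ∃ C, ∀ x i j, |a x i j| ≤ C)
    (ha_symm : ∀ x, (a x).IsSymm)
    (ha_psd : ∀ x (ξ : Fin n → ℝ), 0 ≤ ∑ i, ∑ j, a x i j * ξ i * ξ j)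
    (w : (Fin n → ℝ) → ℝ)
    (hw_meas : Measurable w) (hw_bdd : ∃ C, ∀ x, w x ≤ C) (hw_pos : ∀ x, 0 < w x)
    (φ : (Fin n → ℝ) → ℝ) (hφ : ContDiff ℝ (⊤ : ℕ∞) φ)
    (hφ_bdd : ∀ k : ℕ, ∃ C, ∀ x, ‖iteratedFDeriv ℝ k φ x‖ ≤ C)
    (M : ℝ)
    (hM : M = essSup (fun x => Real.sqrt (∑ i, ∑ j, a x i j *
      (fderiv ℝ φ x (Pi.single i 1)) * (fderiv ℝ φ x (Pi.single j 1)))) volume)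
    (u : (Fin n → ℝ) → ℂ) (hu : ContDiff ℝ (⊤ : ℕ∞) u) (hu_supp : HasCompactSupport u) :
    ‖quadForm n a w u (fun x => (φ x : ℂ) * u x)
        - quadForm n a w (fun x => (φ x : ℂ) * u x) u‖
      ≤ 2 * M * Real.sqrt (∫ x, ‖u x‖ ^ 2 * w x) *
          Real.sqrt ‖quadForm n a w u u‖ := by
  have hw_bdd' : ∃ C, ∀ x, |w x| ≤ C :=
    hw_bdd.imp fun C hC x => (abs_of_pos (hw_pos x)).trans_le (hC x)
  have hu1 : ContDiff ℝ 1 u := hu.of_le (by exact_mod_cast le_top)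
  have hφ1 : ContDiff ℝ 1 φ := hφ.of_le (by exact_mod_cast le_top)
  have hφu1 : ContDiff ℝ 1 fun x => (φ x : ℂ) * u x :=
    (Complex.ofRealCLM.contDiff.comp hφ1).mul hu1
  have hφu_supp : HasCompactSupport fun x => (φ x : ℂ) * u x := hu_supp.mul_left
  have hN_le : ∀ᵐ x, √(∑ i, ∑ j, a x i j *
      (fderiv ℝ φ x (Pi.single i 1)) * (fderiv ℝ φ x (Pi.single j 1))) ≤ M := by
    obtain ⟨K, hK⟩ := exists_sqrt_sum_sum_fderiv_le ha_bdd
      ((hφ_bdd 1).imp fun C hC x => (norm_iteratedFDeriv_one (𝕜 := ℝ) φ).symm.trans_le (hC x))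
    rw [hM]
    exact ae_le_essSup ⟨K, Filter.eventually_map.2 (Filter.Eventually.of_forall hK)⟩
  have hM0 : 0 ≤ M := by
    obtain ⟨x, hx⟩ := hN_le.exists
    exact (Real.sqrt_nonneg _).trans hx
  set E : (Fin n → ℝ) → ℝ := fun x => (∑ i, ∑ j, (a x i j : ℂ) *
    (starRingEnd ℂ) (fderiv ℝ u x (Pi.single i 1)) * (fderiv ℝ u x (Pi.single j 1))).re with hE
  have hE0 (x) : 0 ≤ E x :=
    re_sum_sum_mul_conj_mul_nonneg (ha_symm x) (ha_psd x) fun i => fderiv ℝ u x (Pi.single i 1)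
  have hE_eq (x) : (∑ i, ∑ j, (a x i j : ℂ) * (starRingEnd ℂ) (fderiv ℝ u x (Pi.single i 1)) *
      (fderiv ℝ u x (Pi.single j 1))) * (w x : ℂ) = ((E x * w x : ℝ) : ℂ) := by
    simp only [hE]
    rw [sum_sum_mul_conj_mul_eq_ofReal (ha_symm x) fun i => fderiv ℝ u x (Pi.single i 1),
      Complex.ofReal_re, ← Complex.ofReal_mul]
  have hEw_int : Integrable fun x => E x * w x := by
    have := (integrable_quadForm_integrand ha_meas ha_bdd hw_meas hw_bdd' hu1 hu1 hu_supp).re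
    simp only [hE_eq] at this
    exact this
  have hQ : ‖quadForm n a w u u‖ = ∫ x, E x * w x := by
    simp only [quadForm, hE_eq]
    rw [integral_complex_ofReal, Complex.norm_real, Real.norm_of_nonneg]
    exact integral_nonneg fun x => mul_nonneg (hE0 x) (hw_pos x).le
  obtain ⟨hprod_int, hCS⟩ := integral_mul_sqrt_mul_le (fun x => norm_nonneg (u x)) hE0
    (fun x => (hw_pos x).le) (integrable_norm_sq_mul hu1.continuous hu_supp hw_meas hw_bdd') hEw_int
  rw [hQ, mul_assoc]
  refine le_trans ?_ (mul_le_mul_of_nonneg_left hCS (by positivity))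
  rw [quadForm, quadForm, ← integral_sub
    (integrable_quadForm_integrand ha_meas ha_bdd hw_meas hw_bdd' hu1 hφu1 hu_supp)
    (integrable_quadForm_integrand ha_meas ha_bdd hw_meas hw_bdd' hφu1 hu1 hφu_supp),
    ← integral_const_mul]
  refine norm_integral_le_of_norm_le (hprod_int.const_mul _) ?_
  filter_upwards [hN_le] with x hx
  simp only [fderiv_ofReal_mul_apply (hφ1.differentiable one_ne_zero x)
    (hu1.differentiable one_ne_zero x)]
  rw [← sub_mul, norm_mul, Complex.norm_real, Real.norm_of_nonneg (hw_pos x).le, ← mul_assoc]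
  refine mul_le_mul_of_nonneg_right ?_ (hw_pos x).le
  refine (norm_sum_sum_commutator_le (ha_symm x) (ha_psd x)
    (fun i => fderiv ℝ φ x (Pi.single i 1)) (fun i => fderiv ℝ u x (Pi.single i 1))
    (φ x) (u x)).trans ?_
  gcongr
end
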